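/- arXiv:2408.04359 — 2 statements merged into one kernel-verified Lean document; each statement's English description precedes it below -/
import Mathlib

section
/- Suppose p ≥ 3 and 4·s⋆·log p ≤ n. Then P(λ_min(∑_{i=1}^n X_{i,S}X_{i,S}ᵀ) ≤ n/9 for some S ∈ 𝒮_{s⋆}) ≤ 3·exp(−n/4), and P(λ_max(∑_{i=1}^n X_{i,S}X_{i,S}ᵀ) ≥ 9·n for some S ∈ 𝒮_{s⋆}) ≤ 3·exp(−n/4). -/
open MeasureTheory ProbabilityTheory Matrix Real

/-- The law of an `n × p` matrix with i.i.d. standard normal entries. -/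
noncomputable def gaussMat (n p : ℕ) : Measure (Fin n → Fin p → ℝ) :=
  Measure.pi fun _ : Fin n => Measure.pi fun _ : Fin p => gaussianReal 0 1

/-- Smallest eigenvalue (Rayleigh quotient infimum over unit vectors). -/
noncomputable def lamMin {m : Type*} [Fintype m] (A : Matrix m m ℝ) : ℝ :=
  sInf {r : ℝ | ∃ u : m → ℝ, (∑ i, u i ^ 2) = 1 ∧ r = u ⬝ᵥ A.mulVec u}

/-- Largest eigenvalue (Rayleigh quotient supremum over unit vectors). -/
noncomputable def lamMax {m : Type*} [Fintype m] (A : Matrix m m ℝ) : ℝ :=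
  sSup {r : ℝ | ∃ u : m → ℝ, (∑ i, u i ^ 2) = 1 ∧ r = u ⬝ᵥ A.mulVec u}

/-- Weighted Gram matrix `∑ᵢ wᵢ · X_{i,S} X_{i,S}ᵀ`. -/
noncomputable def gramW {n p : ℕ} (S : Finset (Fin p)) (w : Fin n → ℝ)
    (x : Fin n → Fin p → ℝ) : Matrix S S ℝ :=
  Matrix.of fun j k => ∑ i, w i * x i j.1 * x i k.1

/-- The law of a family of independent standard normal variables. -/
noncomputable abbrev gaussVec (ι : Type*) [Fintype ι] : Measure (ι → ℝ) :=
  Measure.pi fun _ : ι => gaussianReal 0 1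

/-- The coordinates of a standard normal vector along an orthonormal family are independent standard
normal. -/
lemma measurePreserving_gaussVec_of_orthonormal {ι κ : Type*} [Fintype ι] [Fintype κ]
    {b : κ → EuclideanSpace ℝ ι} (hb : Orthonormal ℝ b) :
    MeasurePreserving (fun (y : ι → ℝ) k => ∑ j, b k j * y j) (gaussVec ι) (gaussVec κ) := by
  classical
  refine ⟨by fun_prop, ?_⟩
  let L : EuclideanSpace ℝ ι → EuclideanSpace ℝ κ := fun x => WithLp.toLp 2 fun k => inner ℝ (b k) x
  have hL : Measurable L := by
    apply (WithLp.measurable_toLp 2 _).comp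
    fun_prop
  have key : (stdGaussian (EuclideanSpace ℝ ι)).map L = stdGaussian (EuclideanSpace ℝ κ) := by
    apply Measure.ext_of_charFun
    ext t
    rw [charFun_apply, integral_map hL.aemeasurable (by fun_prop)]
    have h1 : ∀ x, inner ℝ (L x) t = inner ℝ x (∑ k, t k • b k) := by
      intro x
      simp only [L, inner_sum, inner_smul_right, PiLp.inner_apply]
      apply Finset.sum_congr rfl
      intro k _
      simp [mul_comm]
    simp_rw [h1]
    rw [← charFun_apply, charFun_stdGaussian, charFun_stdGaussian]
    have h2 : ‖∑ k, t k • b k‖ ^ 2 = ‖t‖ ^ 2 := by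
      rw [← real_inner_self_eq_norm_sq, hb.inner_sum, EuclideanSpace.real_norm_sq_eq]
      simp [sq]
    congr 2
    exact_mod_cast congrArg Neg.neg h2
  have h3 : (stdGaussian (EuclideanSpace ℝ κ)).map WithLp.ofLp = gaussVec κ := by
    rw [← map_pi_eq_stdGaussian, Measure.map_map (by fun_prop) (by fun_prop)]
    exact Measure.map_id
  rw [← h3, ← key, ← map_pi_eq_stdGaussian, Measure.map_map hL (by fun_prop),
    Measure.map_map (by fun_prop) (by fun_prop)]
  congr 1
  ext y k
  simp [L, PiLp.inner_apply, mul_comm]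

/-- Row-wise version of `measurePreserving_gaussVec_of_orthonormal`. -/
lemma measurePreserving_rows_of_orthonormal {ι κ : Type*} [Fintype ι] [Fintype κ] (n : ℕ)
    {b : κ → EuclideanSpace ℝ ι} (hb : Orthonormal ℝ b) :
    MeasurePreserving (fun (x : Fin n → ι → ℝ) i k => ∑ j, b k j * x i j)
      (Measure.pi fun _ : Fin n => gaussVec ι) (Measure.pi fun _ : Fin n => gaussVec κ) :=
  measurePreserving_pi _ _ fun _ => measurePreserving_gaussVec_of_orthonormal hb

lemma integral_exp_mul_sq_gaussianReal {t : ℝ} (ht : t < 1 / 2) :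
    ∫ y, exp (t * y ^ 2) ∂(gaussianReal 0 1) = (√(1 - 2 * t))⁻¹ := by
  rw [integral_gaussianReal_eq_integral_smul (by norm_num)]
  have h1 : ∀ y : ℝ, gaussianPDFReal 0 1 y • exp (t * y ^ 2)
      = (√(2 * π))⁻¹ * exp (-(1 / 2 - t) * y ^ 2) := by
    intro y
    simp only [gaussianPDFReal, smul_eq_mul, NNReal.coe_one, mul_one, sub_zero]
    rw [mul_assoc, ← exp_add]
    ring_nf
  simp_rw [h1]
  rw [integral_const_mul, integral_gaussian, ← Real.sqrt_inv, ← Real.sqrt_mul (by positivity),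
    ← Real.sqrt_inv]
  congr 1
  have : (1 / 2 - t) ≠ 0 := by linarith
  have : (1 - 2 * t) ≠ 0 := by linarith
  have := pi_pos
  field_simp

lemma integrable_exp_mul_sq_gaussianReal {t : ℝ} (ht : t < 1 / 2) :
    Integrable (fun y => exp (t * y ^ 2)) (gaussianReal 0 1) := by
  by_contra h
  have := integral_exp_mul_sq_gaussianReal ht
  rw [integral_undef h] at this
  have h2 : 0 < (√(1 - 2 * t))⁻¹ := by
    have : 0 < 1 - 2 * t := by linarith
    positivity
  linarith

lemma integrable_exp_mul_sum_sq {κ : Type*} [Fintype κ] {t : ℝ} (ht : t < 1 / 2) :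
    Integrable (fun y : κ → ℝ => exp (t * ∑ k, y k ^ 2)) (gaussVec κ) := by
  simp_rw [Finset.mul_sum, exp_sum]
  exact Integrable.fintype_prod (f := fun _ y => exp (t * y ^ 2))
    fun _ => integrable_exp_mul_sq_gaussianReal ht

lemma mgf_sum_sq_gaussVec {κ : Type*} [Fintype κ] {t : ℝ} (ht : t < 1 / 2) :
    mgf (fun y : κ → ℝ => ∑ k, y k ^ 2) (gaussVec κ) t = (√(1 - 2 * t))⁻¹ ^ Fintype.card κ := by
  simp_rw [mgf, Finset.mul_sum, exp_sum]
  rw [integral_fintype_prod_eq_prod (f := fun _ y => exp (t * y ^ 2))]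
  simp_rw [integral_exp_mul_sq_gaussianReal ht]
  simp

/-- Upper tail of the chi-squared distribution. -/
lemma gaussVec_le_sum_sq {κ : Type*} [Fintype κ] {t : ℝ} (ht0 : 0 ≤ t) (ht : t < 1 / 2) (c : ℝ) :
    gaussVec κ {y | c ≤ ∑ k, y k ^ 2}
      ≤ ENNReal.ofReal (exp (-t * c) * (√(1 - 2 * t))⁻¹ ^ Fintype.card κ) := by
  rw [← mgf_sum_sq_gaussVec ht]
  have := measure_ge_le_exp_mul_mgf c ht0 (integrable_exp_mul_sum_sq (κ := κ) ht)
  exact (ENNReal.le_ofReal_iff_toReal_le (measure_ne_top _ _)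
    (mul_nonneg (exp_pos _).le mgf_nonneg)).2 this

/-- Lower tail of the chi-squared distribution. -/
lemma gaussVec_sum_sq_le {κ : Type*} [Fintype κ] {t : ℝ} (ht0 : 0 ≤ t) (c : ℝ) :
    gaussVec κ {y | ∑ k, y k ^ 2 ≤ c}
      ≤ ENNReal.ofReal (exp (t * c) * (√(1 + 2 * t))⁻¹ ^ Fintype.card κ) := by
  have ht : -t < 1 / 2 := by linarith
  have h1 := mgf_sum_sq_gaussVec (κ := κ) ht
  have := measure_le_le_exp_mul_mgf c (neg_nonpos.2 ht0) (integrable_exp_mul_sum_sq (κ := κ) ht)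
  rw [h1, mul_neg, sub_neg_eq_add, neg_neg] at this
  exact (ENNReal.le_ofReal_iff_toReal_le (measure_ne_top _ _) (by positivity)).2 this

/-- Averaging over a ball: if every outcome in `bad` comes with a large set of directions `v` whose
sections have small probability, then `bad` has small probability. -/
lemma measure_le_of_volume_section {Ω ι : Type*} [MeasurableSpace Ω] [Fintype ι] [Nonempty ι]
    {μ : Measure Ω} [SFinite μ] {A : Set (Ω × EuclideanSpace ℝ ι)} (hA : MeasurableSet A)
    {bad : Set Ω} {r R : ℝ} (hr : 0 < r) (hR : 0 < R) {C δ : ENNReal}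
    (hbad : ∀ x ∈ bad, volume (Metric.ball (0 : EuclideanSpace ℝ ι) r)
      ≤ C * volume ({v | (x, v) ∈ A} ∩ Metric.ball 0 R))
    (hδ : ∀ v, μ {x | (x, v) ∈ A} ≤ δ) :
    μ bad ≤ C * ENNReal.ofReal ((R / r) ^ Fintype.card ι) * δ := by
  set V : ENNReal := volume (Metric.ball (0 : EuclideanSpace ℝ ι) 1) with hV
  have hV0 : V ≠ 0 := (Metric.measure_ball_pos _ _ one_pos).ne'
  have hVt : V ≠ ⊤ := measure_ball_lt_top.ne
  have hball : ∀ ρ : ℝ, 0 < ρ → volume (Metric.ball (0 : EuclideanSpace ℝ ι) ρ)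
      = ENNReal.ofReal (ρ ^ Fintype.card ι) * V := by
    intro ρ hρ
    rw [Measure.addHaar_ball_of_pos _ _ hρ, finrank_euclideanSpace]
  set ν : Measure (EuclideanSpace ℝ ι) := volume.restrict (Metric.ball 0 R) with hν
  have h1 : ∀ x ∈ bad, volume (Metric.ball (0 : EuclideanSpace ℝ ι) r)
      ≤ C * ν (Prod.mk x ⁻¹' A) := by
    intro x hx
    rw [hν, Measure.restrict_apply (measurable_prodMk_left hA)]
    exact hbad x hx
  have hmeas : Measurable fun x => C * ν (Prod.mk x ⁻¹' A) :=
    (measurable_measure_prodMk_left hA).const_mul C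
  have h2 : volume (Metric.ball (0 : EuclideanSpace ℝ ι) r) * μ bad
      ≤ C * (δ * volume (Metric.ball (0 : EuclideanSpace ℝ ι) R)) := by
    calc _ ≤ volume (Metric.ball (0 : EuclideanSpace ℝ ι) r)
          * μ {x | volume (Metric.ball (0 : EuclideanSpace ℝ ι) r) ≤ C * ν (Prod.mk x ⁻¹' A)} := by
          gcongr
          exact h1
      _ ≤ ∫⁻ x, C * ν (Prod.mk x ⁻¹' A) ∂μ := mul_meas_ge_le_lintegral hmeas _
      _ = C * (μ.prod ν) A := by
          rw [lintegral_const_mul _ (measurable_measure_prodMk_left hA), Measure.prod_apply hA]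
      _ = C * ∫⁻ v, μ ((fun x => (x, v)) ⁻¹' A) ∂ν := by rw [Measure.prod_apply_symm hA]
      _ ≤ C * ∫⁻ _, δ ∂ν := by
          gcongr with v
          exact hδ v
      _ = _ := by simp [hν]
  rw [hball r hr, hball R hR] at h2
  have hrs : 0 < r ^ Fintype.card ι := by positivity
  rw [div_pow, ENNReal.ofReal_div_of_pos hrs]
  set a := ENNReal.ofReal (r ^ Fintype.card ι)
  have ha0 : a ≠ 0 := by simpa [a] using hrs
  have hat : a ≠ ⊤ := ENNReal.ofReal_ne_top
  set b := ENNReal.ofReal (R ^ Fintype.card ι)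
  have h3 : a * V * μ bad ≤ a * V * (C * (b / a) * δ) := by
    refine h2.trans (le_of_eq ?_)
    calc C * (δ * (b * V)) = C * b * δ * V := by ring
      _ = C * (a * (b / a)) * δ * V := by rw [ENNReal.mul_div_cancel ha0 hat]
      _ = _ := by ring
  exact (ENNReal.mul_le_mul_iff_right (mul_ne_zero ha0 hV0) (ENNReal.mul_ne_top hat hVt)).1 h3

/-- A ball is no larger than the part of a double cone around a unit vector lying in a larger
ball. -/
lemma volume_ball_le_volume_cone {E : Type*} [NormedAddCommGroup E] [InnerProductSpace ℝ E]
    [FiniteDimensional ℝ E] [MeasurableSpace E] [BorelSpace E] {u : E} (hu : ‖u‖ = 1) {a : ℝ}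
    (ha0 : 0 < a) (ha1 : a < 1) :
    volume (Metric.ball (0 : E) (√a))
      ≤ volume ({v : E | (1 - a) * ‖v‖ ^ 2 < inner ℝ u v ^ 2} ∩ Metric.ball 0 (√(1 + a))) := by
  set G := {v : E | (1 - a) * ‖v‖ ^ 2 < inner ℝ u v ^ 2} ∩ Metric.ball 0 (√(1 + a)) with hG
  have hGm : MeasurableSet G := by
    refine (measurableSet_lt ?_ ?_).inter Metric.isOpen_ball.measurableSet
    · fun_prop
    · fun_prop
  have hpos : MeasurableSet {v : E | 0 < inner ℝ u v} :=
    measurableSet_lt measurable_const (by fun_prop)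
  have hgeo : ∀ z : E, ‖z‖ < √a → inner ℝ u z ≤ 0 → u + z ∈ G ∧ 0 < inner ℝ u (u + z) := by
    intro z hz hz1
    have hz2 : ‖z‖ ^ 2 < a := by
      have := Real.sq_sqrt ha0.le
      nlinarith [norm_nonneg z, Real.sqrt_nonneg a]
    have hcs := abs_real_inner_le_norm u z
    rw [hu, one_mul] at hcs
    have hlt : ‖z‖ < 1 := by nlinarith [norm_nonneg z]
    have hin : inner ℝ u (u + z) = 1 + inner ℝ u z := by
      rw [inner_add_right, real_inner_self_eq_norm_sq, hu]; norm_num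
    have hnorm : ‖u + z‖ ^ 2 = 1 + 2 * inner ℝ u z + ‖z‖ ^ 2 := by
      rw [norm_add_sq_real, hu]; norm_num
    have hge := (abs_le.1 hcs).1
    refine ⟨⟨?_, ?_⟩, by rw [hin]; linarith⟩
    · simp only [Set.mem_ofPred_eq]
      rw [hin, hnorm]
      nlinarith [sq_nonneg (inner ℝ u z + a)]
    · rw [mem_ball_zero_iff]
      apply Real.lt_sqrt_of_sq_lt
      rw [hnorm]; linarith
  have hneg : ∀ v ∈ G, -v ∈ G := by
    intro v hv
    simpa [hG] using hv
  have hsub : Metric.ball (0 : E) (√a) ⊆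
      (fun z => u + z) ⁻¹' (G ∩ {v : E | 0 < inner ℝ u v}) ∪
      (fun z => -u + z) ⁻¹' (G \ {v : E | 0 < inner ℝ u v}) := by
    intro z hz
    rw [mem_ball_zero_iff] at hz
    rcases le_or_gt (inner ℝ u z) 0 with h | h
    · exact Or.inl (hgeo z hz h)
    · right
      have := hgeo (-z) (by simpa using hz) (by rw [inner_neg_right]; linarith)
      refine ⟨?_, ?_⟩
      · have h2 := hneg _ this.1
        rwa [neg_add, neg_neg] at h2
      · have h2 := this.2
        simp only [Set.mem_ofPred_eq, not_lt]
        rw [inner_add_right, inner_neg_right] at h2 ⊢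
        linarith
  calc _ ≤ _ := measure_mono hsub
    _ ≤ _ := measure_union_le _ _
    _ = volume (G ∩ {v : E | 0 < inner ℝ u v}) + volume (G \ {v : E | 0 < inner ℝ u v}) := by
        rw [measure_preimage_add, measure_preimage_add]
    _ = volume G := measure_inter_add_sdiff _ hpos

/-- A function satisfying a parallelogram inequality is large at a translate of `w` for at least
half of all translations. -/
lemma volume_ball_le_two_mul_volume {E : Type*} [NormedAddCommGroup E] [InnerProductSpace ℝ E]
    [FiniteDimensional ℝ E] [MeasurableSpace E] [BorelSpace E] {Q : E → ℝ} {w : E} (hw : ‖w‖ = 1)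
    (hQ : ∀ z, 2 * Q w ≤ Q (w + z) + Q (w - z)) {c : ℝ} (hc : c ≤ Q w) {ρ : ℝ} :
    volume (Metric.ball (0 : E) ρ) ≤ 2 * volume ({v : E | c ≤ Q v} ∩ Metric.ball 0 (1 + ρ)) := by
  set G := {v : E | c ≤ Q v} ∩ Metric.ball 0 (1 + ρ) with hG
  have hsub : Metric.ball (0 : E) ρ ⊆ (fun z => w + z) ⁻¹' G ∪ (fun z => w - z) ⁻¹' G := by
    intro z hz
    rw [mem_ball_zero_iff] at hz
    have h1 := hQ z
    rcases le_or_gt c (Q (w + z)) with h | h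
    · refine Or.inl ⟨h, ?_⟩
      rw [mem_ball_zero_iff]
      linarith [norm_add_le w z]
    · refine Or.inr ⟨by simp only [Set.mem_ofPred_eq]; linarith, ?_⟩
      rw [mem_ball_zero_iff]
      linarith [norm_sub_le w z]
  calc _ ≤ _ := measure_mono hsub
    _ ≤ _ := measure_union_le _ _
    _ = volume G + volume G := by
        rw [measure_preimage_add]
        congr 1
        have : (fun z => w - z) ⁻¹' G = Neg.neg ⁻¹' ((fun z => w + z) ⁻¹' G) := by
          ext z; simp [sub_eq_add_neg]
        rw [this, Measure.measure_preimage_neg, measure_preimage_add]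
    _ = 2 * volume G := (two_mul _).symm

/-- The quadratic form `w ↦ ‖X w‖²`. -/
noncomputable def quadRows {n : ℕ} {ι : Type*} [Fintype ι] (x : Fin n → ι → ℝ) (w : ι → ℝ) : ℝ :=
  ∑ i, (∑ j, x i j * w j) ^ 2

lemma quadRows_nonneg {n : ℕ} {ι : Type*} [Fintype ι] (x : Fin n → ι → ℝ) (w : ι → ℝ) :
    0 ≤ quadRows x w := Finset.sum_nonneg fun _ _ => sq_nonneg _

lemma quadRows_smul {n : ℕ} {ι : Type*} [Fintype ι] (x : Fin n → ι → ℝ) (c : ℝ) (w : ι → ℝ) :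
    quadRows x (c • w) = c ^ 2 * quadRows x w := by
  simp only [quadRows, Finset.mul_sum, Pi.smul_apply, smul_eq_mul]
  refine Finset.sum_congr rfl fun i _ => ?_
  rw [← mul_pow, Finset.mul_sum]
  congr 1
  exact Finset.sum_congr rfl fun j _ => by ring

lemma quadRows_add_add_sub {n : ℕ} {ι : Type*} [Fintype ι] (x : Fin n → ι → ℝ) (w z : ι → ℝ) :
    quadRows x (w + z) + quadRows x (w - z) = 2 * quadRows x w + 2 * quadRows x z := by
  simp only [quadRows, Finset.mul_sum, ← Finset.sum_add_distrib, Pi.add_apply, Pi.sub_apply,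
    mul_add, mul_sub, Finset.sum_sub_distrib]
  refine Finset.sum_congr rfl fun i _ => ?_
  rw [Finset.sum_add_distrib]
  ring

lemma continuous_quadRows {n : ℕ} {ι : Type*} [Fintype ι] :
    Continuous fun q : (Fin n → ι → ℝ) × (ι → ℝ) => quadRows q.1 q.2 := by
  unfold quadRows
  fun_prop

/-- For a fixed unit vector `v`, the vector `X v` is standard normal. -/
lemma measurePreserving_mulVec_of_unit {ι : Type*} [Fintype ι] (n : ℕ) {v : EuclideanSpace ℝ ι}
    (hv : ‖v‖ = 1) :
    MeasurePreserving (fun (x : Fin n → ι → ℝ) i => ∑ j, x i j * v j)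
      (Measure.pi fun _ : Fin n => gaussVec ι) (gaussVec (Fin n)) := by
  have hb : Orthonormal ℝ (fun _ : Unit => v) :=
    ⟨fun _ => hv, fun i j h => (h (Subsingleton.elim i j)).elim⟩
  refine measurePreserving_pi (fun _ : Fin n => gaussVec ι) (fun _ : Fin n => gaussianReal 0 1)
    (f := fun _ y => ∑ j, y j * v j) fun _ => ?_
  have h1 := measurePreserving_gaussVec_of_orthonormal hb
  have h2 := measurePreserving_funUnique (gaussianReal 0 1) Unit
  convert h2.comp h1 using 1
  ext y
  simp [mul_comm]

lemma quadRows_upper_tail {ι : Type*} [Fintype ι] (n : ℕ) {c R t : ℝ} (hc : 0 < c) (ht0 : 0 ≤ t)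
    (ht : t < 1 / 2) {v : EuclideanSpace ℝ ι} (hv : ‖v‖ < R) :
    (Measure.pi fun _ : Fin n => gaussVec ι) {x | c ≤ quadRows x v}
      ≤ ENNReal.ofReal (exp (-t * (c / R ^ 2)) * (√(1 - 2 * t))⁻¹ ^ n) := by
  rcases eq_or_ne v 0 with rfl | h0
  · have : {x : Fin n → ι → ℝ | c ≤ quadRows x (0 : EuclideanSpace ℝ ι)} = ∅ := by
      ext x; simp [quadRows, hc]
    rw [this]; simp
  have hvn : 0 < ‖v‖ := norm_pos_iff.2 h0
  have hu : ‖(‖v‖⁻¹ • v)‖ = 1 := norm_smul_inv_norm (𝕜 := ℝ) h0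
  have hmp := measurePreserving_mulVec_of_unit n hu
  have hsub : {x : Fin n → ι → ℝ | c ≤ quadRows x v} ⊆
      (fun (x : Fin n → ι → ℝ) i => ∑ j, x i j * (‖v‖⁻¹ • v) j) ⁻¹'
        {y | c / R ^ 2 ≤ ∑ k, y k ^ 2} := by
    intro x hx
    have h1 : quadRows x (‖v‖⁻¹ • v) = ‖v‖⁻¹ ^ 2 * quadRows x v := quadRows_smul x ‖v‖⁻¹ v
    change c / R ^ 2 ≤ quadRows x (‖v‖⁻¹ • v)
    rw [h1, inv_pow, ← div_eq_inv_mul]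
    exact div_le_div₀ (quadRows_nonneg _ _) hx (by positivity) (by gcongr)
  calc _ ≤ _ := measure_mono hsub
    _ = _ := hmp.measure_preimage (measurableSet_le measurable_const (by fun_prop)).nullMeasurableSet
    _ ≤ _ := by simpa using gaussVec_le_sum_sq (κ := Fin n) ht0 ht (c / R ^ 2)

/-- Upper tail of the largest eigenvalue of a Gaussian Gram matrix. -/
lemma exists_unit_quadRows_ge {ι : Type*} [Fintype ι] [Nonempty ι] (n : ℕ) (hn : 1 ≤ n) :
    (Measure.pi fun _ : Fin n => gaussVec ι)
        {x | ∃ w : EuclideanSpace ℝ ι, ‖w‖ = 1 ∧ 9 * (n : ℝ) ≤ quadRows x w}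
      ≤ ENNReal.ofReal (2 * 3 ^ Fintype.card ι * (2 * exp (-(3 / 2))) ^ n) := by
  have hn' : (0 : ℝ) < n := by exact_mod_cast hn
  have hA : MeasurableSet {q : (Fin n → ι → ℝ) × EuclideanSpace ℝ ι |
      9 * (n : ℝ) ≤ quadRows q.1 q.2 ∧ ‖q.2‖ < 3 / 2} := by
    have h : Continuous fun q : (Fin n → ι → ℝ) × EuclideanSpace ℝ ι => quadRows q.1 q.2 :=
      continuous_quadRows.comp (f := fun q : (Fin n → ι → ℝ) × EuclideanSpace ℝ ι =>
        (q.1, (q.2 : ι → ℝ))) (by fun_prop)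
    have h' : Measurable fun q : (Fin n → ι → ℝ) × EuclideanSpace ℝ ι => ‖q.2‖ := by fun_prop
    exact (measurableSet_le measurable_const h.measurable).inter
      (measurableSet_lt h' measurable_const)
  refine (measure_le_of_volume_section (r := 1 / 2) (R := 3 / 2) (C := 2)
    (δ := ENNReal.ofReal (exp (-(3 / 8) * (9 * n / (3 / 2) ^ 2)) * (√(1 - 2 * (3 / 8)))⁻¹ ^ n))
    hA (by norm_num) (by norm_num) ?_ ?_).trans (le_of_eq ?_)
  · rintro x ⟨w, hw, hx⟩
    have h := volume_ball_le_two_mul_volume (Q := fun v : EuclideanSpace ℝ ι => quadRows x v) hw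
      (c := 9 * n) (ρ := 1 / 2) (fun z => ?_) hx
    · refine h.trans ?_
      gcongr 2 * volume ?_
      intro v hv
      have hv2 := mem_ball_zero_iff.1 hv.2
      exact ⟨⟨hv.1, by linarith⟩, by rw [mem_ball_zero_iff]; linarith⟩
    · have := quadRows_add_add_sub x w z
      have h2 := quadRows_nonneg x z
      simp only [WithLp.ofLp_add, WithLp.ofLp_sub]
      linarith
  · intro v
    by_cases hv : ‖v‖ < 3 / 2
    · refine le_trans (measure_mono fun x hx => hx.1) (quadRows_upper_tail n (by positivity)
        (by norm_num) (by norm_num) hv)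
    · have : {x : Fin n → ι → ℝ | (x, v) ∈ {q : (Fin n → ι → ℝ) × EuclideanSpace ℝ ι |
          9 * (n : ℝ) ≤ quadRows q.1 q.2 ∧ ‖q.2‖ < 3 / 2}} = ∅ := by
        ext x; simp [hv]
      rw [this]; simp
  · have h2 : (2 : ENNReal) = ENNReal.ofReal 2 := by simp
    rw [h2, ← ENNReal.ofReal_mul (by norm_num), ← ENNReal.ofReal_mul (by positivity)]
    congr 1
    have h4 : √(1 - 2 * (3 / 8)) = 1 / 2 := by
      rw [show (1 - 2 * (3 / 8) : ℝ) = (1 / 2) ^ 2 by norm_num]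
      exact Real.sqrt_sq (by norm_num)
    rw [h4, mul_pow, ← Real.exp_nat_mul]
    norm_num
    ring_nf

/-- The probability that a standard normal vector is close to a fixed low-dimensional subspace. -/
lemma gaussVec_near_submodule {ι : Type*} [Fintype ι]
    (E : Submodule ℝ (EuclideanSpace ℝ ι)) {k : ℕ} (hk : Module.finrank ℝ E ≤ k) {t r : ℝ}
    (ht : 0 ≤ t) :
    gaussVec ι {ξ | ∃ e ∈ E, ‖WithLp.toLp 2 ξ - e‖ ^ 2 < r}
      ≤ ENNReal.ofReal (exp (t * r) * (√(1 + 2 * t))⁻¹ ^ (Fintype.card ι - k)) := by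
  let b := stdOrthonormalBasis ℝ Eᗮ
  have hb : Orthonormal ℝ fun l => (b l : EuclideanSpace ℝ ι) :=
    b.orthonormal.comp_linearIsometry Eᗮ.subtypeₗᵢ
  have hd : Fintype.card ι - k ≤ Module.finrank ℝ Eᗮ := by
    have := E.finrank_add_finrank_orthogonal
    rw [finrank_euclideanSpace] at this
    omega
  have hmp := measurePreserving_gaussVec_of_orthonormal hb
  have hsub : {ξ : ι → ℝ | ∃ e ∈ E, ‖WithLp.toLp 2 ξ - e‖ ^ 2 < r} ⊆
      (fun (y : ι → ℝ) l => ∑ j, (b l : EuclideanSpace ℝ ι) j * y j) ⁻¹'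
        {y | ∑ l, y l ^ 2 ≤ r} := by
    rintro ξ ⟨e, he, hr⟩
    have hB := hb.sum_inner_products_le (s := Finset.univ) (WithLp.toLp 2 ξ - e)
    refine le_trans (le_of_eq ?_) (hB.trans hr.le)
    refine Finset.sum_congr rfl fun l _ => ?_
    rw [inner_sub_right, Submodule.inner_left_of_mem_orthogonal he (b l).2, sub_zero,
      Real.norm_eq_abs, sq_abs, PiLp.inner_apply]
    simp [mul_comm]
  have hm : MeasurableSet {y : Fin (Module.finrank ℝ Eᗮ) → ℝ | ∑ l, y l ^ 2 ≤ r} :=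
    measurableSet_le (by fun_prop) measurable_const
  calc _ ≤ _ := measure_mono hsub
    _ = _ := hmp.measure_preimage hm.nullMeasurableSet
    _ ≤ _ := gaussVec_sum_sq_le ht r
    _ ≤ _ := by
      rw [Fintype.card_fin]
      gcongr ENNReal.ofReal (_ * ?_)
      refine pow_le_pow_of_le_one (by positivity) ?_ hd
      exact inv_le_one_of_one_le₀ (Real.one_le_sqrt.2 (by linarith))

/-- Splitting off the first column of a Gaussian matrix. -/
lemma measurePreserving_split_column (n k : ℕ) :
    MeasurePreserving
      (fun x : Fin n → Fin (k + 1) → ℝ => (fun i => x i 0, fun i (l : Fin k) => x i l.succ))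
      (Measure.pi fun _ : Fin n => gaussVec (Fin (k + 1)))
      ((gaussVec (Fin n)).prod (Measure.pi fun _ : Fin n => gaussVec (Fin k))) := by
  have h1 := measurePreserving_piFinSuccAbove (fun _ : Fin (k + 1) => gaussianReal 0 1) 0
  have h2 := measurePreserving_pi (fun _ : Fin n => gaussVec (Fin (k + 1)))
    (fun _ : Fin n => (gaussianReal 0 1).prod (gaussVec (Fin k))) fun _ => h1
  exact (measurePreserving_arrowProdEquivProdArrow ℝ (Fin k → ℝ) (Fin n)
    (fun _ => gaussianReal 0 1) (fun _ => gaussVec (Fin k))).comp h2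

lemma quadRows_lt_head_tail (n k : ℕ) {t r : ℝ} (ht : 0 ≤ t) :
    (Measure.pi fun _ : Fin n => gaussVec (Fin (k + 1)))
        {x | ∃ c : Fin (k + 1) → ℝ, quadRows x c < r * c 0 ^ 2}
      ≤ ENNReal.ofReal (exp (t * r) * (√(1 + 2 * t))⁻¹ ^ (n - k)) := by
  set B : Set ((Fin n → ℝ) × (Fin n → Fin k → ℝ)) :=
    {q | ∃ c : Fin k → ℝ, ∑ i, (q.1 i + ∑ l, q.2 i l * c l) ^ 2 < r} with hB
  have hBm : MeasurableSet B := by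
    have : B = ⋃ c : Fin k → ℝ, {q | ∑ i, (q.1 i + ∑ l, q.2 i l * c l) ^ 2 < r} := by
      ext q; simp [hB]
    rw [this]
    exact (isOpen_iUnion fun c => isOpen_lt (by fun_prop) continuous_const).measurableSet
  have hsub : {x : Fin n → Fin (k + 1) → ℝ | ∃ c : Fin (k + 1) → ℝ, quadRows x c < r * c 0 ^ 2} ⊆
      (fun x : Fin n → Fin (k + 1) → ℝ =>
        ((fun i => x i 0, fun i (l : Fin k) => x i l.succ) : (Fin n → ℝ) × (Fin n → Fin k → ℝ))) ⁻¹'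
        B := by
    rintro x ⟨c, hc⟩
    have h0 : c 0 ≠ 0 := by
      intro h
      rw [h] at hc
      have := quadRows_nonneg x c
      norm_num at hc
      linarith
    refine ⟨fun l => (c 0)⁻¹ * c l.succ, ?_⟩
    have h1 := quadRows_smul x (c 0)⁻¹ c
    have h2 : quadRows x ((c 0)⁻¹ • c)
        = ∑ i, (x i 0 + ∑ l : Fin k, x i l.succ * ((c 0)⁻¹ * c l.succ)) ^ 2 := by
      simp [quadRows, Fin.sum_univ_succ, h0]
    rw [← h2, h1, inv_pow, inv_mul_lt_iff₀ (by positivity), mul_comm]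
    exact hc
  calc _ ≤ _ := measure_mono hsub
    _ = _ := (measurePreserving_split_column n k).measure_preimage hBm.nullMeasurableSet
    _ = ∫⁻ Z, gaussVec (Fin n) ((fun ξ => (ξ, Z)) ⁻¹' B)
          ∂(Measure.pi fun _ : Fin n => gaussVec (Fin k)) := Measure.prod_apply_symm hBm
    _ ≤ ∫⁻ _, ENNReal.ofReal (exp (t * r) * (√(1 + 2 * t))⁻¹ ^ (n - k))
          ∂(Measure.pi fun _ : Fin n => gaussVec (Fin k)) := by
      gcongr with Z
      let f : (Fin k → ℝ) →ₗ[ℝ] EuclideanSpace ℝ (Fin n) :=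
        (WithLp.linearEquiv 2 ℝ (Fin n → ℝ)).symm.toLinearMap ∘ₗ (Matrix.of Z).mulVecLin
      have hf : Module.finrank ℝ (LinearMap.range f) ≤ k := by
        simpa using LinearMap.finrank_range_le f
      have h := gaussVec_near_submodule (LinearMap.range f) hf (r := r) ht
      rw [Fintype.card_fin] at h
      refine le_trans (measure_mono ?_) h
      rintro ξ ⟨c, hc⟩
      refine ⟨f (-c), LinearMap.mem_range_self f _, ?_⟩
      rw [EuclideanSpace.real_norm_sq_eq]
      refine lt_of_eq_of_lt ?_ hc
      refine Finset.sum_congr rfl fun i _ => ?_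
      simp [f, Matrix.mulVec, dotProduct]
    _ = _ := by simp

lemma quadRows_lt_inner (n : ℕ) {ι : Type*} [Fintype ι] {t r : ℝ} (ht : 0 ≤ t)
    (v : EuclideanSpace ℝ ι) :
    (Measure.pi fun _ : Fin n => gaussVec ι)
        {x | ∃ w : EuclideanSpace ℝ ι, quadRows x w * ‖v‖ ^ 2 < r * inner ℝ w v ^ 2}
      ≤ ENNReal.ofReal (exp (t * r) * (√(1 + 2 * t))⁻¹ ^ (n - (Fintype.card ι - 1))) := by
  rcases eq_or_ne v 0 with rfl | h0
  · simp
  have hvn : 0 < ‖v‖ := norm_pos_iff.2 h0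
  obtain ⟨k, hk⟩ : ∃ k, Fintype.card ι = k + 1 := by
    refine Nat.exists_eq_succ_of_ne_zero fun h => h0 ?_
    have := Fintype.card_eq_zero_iff.1 h
    ext j; exact this.elim j
  rw [hk, Nat.add_sub_cancel]
  set u : EuclideanSpace ℝ ι := ‖v‖⁻¹ • v with hu
  have hun : ‖u‖ = 1 := norm_smul_inv_norm (𝕜 := ℝ) h0
  obtain ⟨b, hb⟩ := Orthonormal.exists_orthonormalBasis_extension_of_card_eq (𝕜 := ℝ)
    (E := EuclideanSpace ℝ ι) (ι := Fin (k + 1)) (by simp [hk]) (v := fun _ => u) (s := {0})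
    ⟨fun _ => hun, fun i j h => (h (Subsingleton.elim i j)).elim⟩
  have hb0 : b 0 = u := hb 0 rfl
  have hmp := measurePreserving_rows_of_orthonormal n b.orthonormal
  have hm : MeasurableSet {x : Fin n → Fin (k + 1) → ℝ |
      ∃ c : Fin (k + 1) → ℝ, quadRows x c < r * c 0 ^ 2} := by
    have : {x : Fin n → Fin (k + 1) → ℝ | ∃ c : Fin (k + 1) → ℝ, quadRows x c < r * c 0 ^ 2}
        = ⋃ c : Fin (k + 1) → ℝ, {x | quadRows x c < r * c 0 ^ 2} := by ext x; simp
    rw [this]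
    refine (isOpen_iUnion fun c => isOpen_lt ?_ continuous_const).measurableSet
    exact continuous_quadRows.comp (f := fun x : Fin n → Fin (k + 1) → ℝ => (x, c)) (by fun_prop)
  refine le_trans (measure_mono ?_) ((hmp.measure_preimage hm.nullMeasurableSet).trans_le
    (quadRows_lt_head_tail n k ht))
  rintro x ⟨w, hw⟩
  refine ⟨fun l => inner ℝ (b l) w, ?_⟩
  have hq : quadRows (fun i l => ∑ j, b l j * x i j) (fun l => inner ℝ (b l) w)
      = quadRows x w := by
    refine Finset.sum_congr rfl fun i _ => ?_
    congr 1
    have h1 := b.sum_inner_mul_inner (WithLp.toLp 2 (x i)) w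
    have h2 : inner ℝ (WithLp.toLp 2 (x i)) w = ∑ j, x i j * w j := by
      simp [PiLp.inner_apply, mul_comm]
    rw [h2] at h1
    rw [← h1]
    refine Finset.sum_congr rfl fun l _ => ?_
    simp [PiLp.inner_apply]
  rw [hq]
  change quadRows x w < r * inner ℝ (b 0) w ^ 2
  rw [hb0, hu, real_inner_smul_left, mul_pow, inv_pow, real_inner_comm, mul_left_comm,
    lt_inv_mul_iff₀ (by positivity), mul_comm]
  exact hw

/-- Lower tail of the smallest eigenvalue of a Gaussian Gram matrix. -/
lemma exists_unit_quadRows_le {ι : Type*} [Fintype ι] [Nonempty ι] (n : ℕ) {a t m : ℝ}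
    (ha0 : 0 < a) (ha1 : a < 1) (ht : 0 ≤ t) (hm : 0 < m) :
    (Measure.pi fun _ : Fin n => gaussVec ι)
        {x | ∃ w : EuclideanSpace ℝ ι, ‖w‖ = 1 ∧ quadRows x w ≤ m}
      ≤ ENNReal.ofReal (√((1 + a) / a) ^ Fintype.card ι *
          (exp (t * (m / (1 - a))) * (√(1 + 2 * t))⁻¹ ^ (n - (Fintype.card ι - 1)))) := by
  have hA : MeasurableSet {q : (Fin n → ι → ℝ) × EuclideanSpace ℝ ι |
      ∃ w : EuclideanSpace ℝ ι,
        quadRows q.1 w * ‖q.2‖ ^ 2 < m / (1 - a) * inner ℝ w q.2 ^ 2} := by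
    have : {q : (Fin n → ι → ℝ) × EuclideanSpace ℝ ι | ∃ w : EuclideanSpace ℝ ι,
        quadRows q.1 w * ‖q.2‖ ^ 2 < m / (1 - a) * inner ℝ w q.2 ^ 2}
        = ⋃ w : EuclideanSpace ℝ ι,
          {q | quadRows q.1 w * ‖q.2‖ ^ 2 < m / (1 - a) * inner ℝ w q.2 ^ 2} := by ext q; simp
    rw [this]
    refine (isOpen_iUnion fun w => isOpen_lt ?_ (by fun_prop)).measurableSet
    have h : Continuous fun q : (Fin n → ι → ℝ) × EuclideanSpace ℝ ι => quadRows q.1 w :=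
      continuous_quadRows.comp (f := fun q : (Fin n → ι → ℝ) × EuclideanSpace ℝ ι =>
        (q.1, (w : ι → ℝ))) (by fun_prop)
    fun_prop
  refine (measure_le_of_volume_section (r := √a) (R := √(1 + a)) (C := 1) hA
    (by positivity) (by positivity) ?_ fun v => quadRows_lt_inner n ht v).trans (le_of_eq ?_)
  · rintro x ⟨w, hw, hx⟩
    rw [one_mul]
    refine (volume_ball_le_volume_cone hw ha0 ha1).trans (measure_mono ?_)
    refine Set.inter_subset_inter_left _ fun v hv => ⟨w, ?_⟩
    have h1 : 0 < 1 - a := by linarith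
    have hv' : (1 - a) * ‖v‖ ^ 2 < inner ℝ w v ^ 2 := hv
    rw [div_mul_eq_mul_div, lt_div_iff₀ h1]
    calc quadRows x w * ‖v‖ ^ 2 * (1 - a) ≤ m * ‖v‖ ^ 2 * (1 - a) := by gcongr
      _ = m * ((1 - a) * ‖v‖ ^ 2) := by ring
      _ < _ := by gcongr
  · rw [one_mul, ← ENNReal.ofReal_mul (by positivity), Real.sqrt_div (by linarith)]

lemma dotProduct_gramW_mulVec {n p : ℕ} (S : Finset (Fin p)) (x : Fin n → Fin p → ℝ) (u : S → ℝ) :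
    u ⬝ᵥ (gramW S (fun _ => 1) x).mulVec u = quadRows (fun i (j : S) => x i j) u := by
  have h : ∀ j : S, u j * ∑ k : S, (∑ i, 1 * x i j * x i k) * u k
      = ∑ i, ∑ k : S, (x i j * u j) * (x i k * u k) := by
    intro j
    simp only [one_mul, Finset.sum_mul, Finset.mul_sum]
    rw [Finset.sum_comm]
    exact Finset.sum_congr rfl fun i _ => Finset.sum_congr rfl fun k _ => by ring
  simp only [dotProduct, Matrix.mulVec, gramW, Matrix.of_apply, quadRows]
  simp_rw [h, sq, Finset.sum_mul_sum]
  exact Finset.sum_comm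

/-- The Rayleigh quotients of a matrix over unit vectors form a nonempty compact set. -/
lemma isCompact_rayleigh {m : Type*} [Fintype m] (A : Matrix m m ℝ) :
    IsCompact {r : ℝ | ∃ u : m → ℝ, (∑ i, u i ^ 2) = 1 ∧ r = u ⬝ᵥ A.mulVec u} := by
  have h : {r : ℝ | ∃ u : m → ℝ, (∑ i, u i ^ 2) = 1 ∧ r = u ⬝ᵥ A.mulVec u}
      = (fun u : EuclideanSpace ℝ m => u.ofLp ⬝ᵥ A.mulVec u.ofLp) '' Metric.sphere 0 1 := by
    ext r
    constructor
    · rintro ⟨u, hu, rfl⟩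
      refine ⟨WithLp.toLp 2 u, ?_, rfl⟩
      simp [EuclideanSpace.norm_eq, hu]
    · rintro ⟨u, hu, rfl⟩
      refine ⟨u, ?_, rfl⟩
      rw [← EuclideanSpace.real_norm_sq_eq, mem_sphere_zero_iff_norm.1 hu, one_pow]
  rw [h]
  refine (isCompact_sphere _ _).image ?_
  simp only [dotProduct, Matrix.mulVec]
  fun_prop

lemma rayleigh_nonempty {m : Type*} [Fintype m] [Nonempty m] (A : Matrix m m ℝ) :
    {r : ℝ | ∃ u : m → ℝ, (∑ i, u i ^ 2) = 1 ∧ r = u ⬝ᵥ A.mulVec u}.Nonempty := by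
  classical
  obtain ⟨j⟩ := ‹Nonempty m›
  exact ⟨_, Pi.single j 1, by simp [Pi.single_apply], rfl⟩

lemma lamMin_mem {m : Type*} [Fintype m] [Nonempty m] (A : Matrix m m ℝ) :
    ∃ u : EuclideanSpace ℝ m, ‖u‖ = 1 ∧ lamMin A = u.ofLp ⬝ᵥ A.mulVec u.ofLp := by
  obtain ⟨u, hu, h⟩ := (isCompact_rayleigh A).sInf_mem (rayleigh_nonempty A)
  exact ⟨WithLp.toLp 2 u, by simp [EuclideanSpace.norm_eq, hu], h⟩

lemma lamMax_mem {m : Type*} [Fintype m] [Nonempty m] (A : Matrix m m ℝ) :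
    ∃ u : EuclideanSpace ℝ m, ‖u‖ = 1 ∧ lamMax A = u.ofLp ⬝ᵥ A.mulVec u.ofLp := by
  obtain ⟨u, hu, h⟩ := (isCompact_rayleigh A).sSup_mem (rayleigh_nonempty A)
  exact ⟨WithLp.toLp 2 u, by simp [EuclideanSpace.norm_eq, hu], h⟩

/-- A unit vector supported on `S` extends by zero to any larger set of coordinates. -/
lemma exists_unit_extend {n p : ℕ} {S T : Finset (Fin p)} (hST : S ⊆ T) (x : Fin n → Fin p → ℝ)
    (w : EuclideanSpace ℝ S) (hw : ‖w‖ = 1) :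
    ∃ w' : EuclideanSpace ℝ T, ‖w'‖ = 1 ∧
      quadRows (fun i (j : T) => x i j) w' = quadRows (fun i (j : S) => x i j) w := by
  let e : Fin p → ℝ := fun j => if h : j ∈ S then w ⟨j, h⟩ else 0
  have hsum : ∀ g : Fin p → ℝ, (∀ j, e j = 0 → g j = 0) → ∑ j : T, g j = ∑ j : S, g j := by
    intro g hg
    rw [Finset.sum_coe_sort T g, Finset.sum_coe_sort S g]
    exact (Finset.sum_subset hST fun j _ hj => hg j (by simp [e, hj])).symm
  have he : ∀ j : S, e j = w j := by
    intro j
    simp [e]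
  refine ⟨WithLp.toLp 2 fun j : T => e j, ?_, ?_⟩
  · rw [EuclideanSpace.norm_eq] at hw ⊢
    rw [← hw]
    congr 1
    simp only [Real.norm_eq_abs, sq_abs]
    rw [hsum (fun j => e j ^ 2) (by simp)]
    simp_rw [he]
  · refine Finset.sum_congr rfl fun i _ => ?_
    congr 1
    change ∑ j : T, x i j * e j = _
    rw [hsum (fun j => x i j * e j) fun j hj => by simp [hj]]
    simp_rw [he]

/-- Union bound over all coordinate subsets of size at most `s`. -/
lemma gaussMat_union_bound {n p s : ℕ} (hsp : s ≤ p) {P : ℝ → Prop} {B : ENNReal}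
    (hB : ∀ T : Finset (Fin p), T.card = s →
      (Measure.pi fun _ : Fin n => gaussVec T)
        {x | ∃ w : EuclideanSpace ℝ T, ‖w‖ = 1 ∧ P (quadRows x w)} ≤ B) :
    gaussMat n p {x | ∃ S : Finset (Fin p), S.card ≤ s ∧
        ∃ w : EuclideanSpace ℝ S, ‖w‖ = 1 ∧ P (quadRows (fun i (j : S) => x i j) w)}
      ≤ p.choose s * B := by
  have hsub : {x : Fin n → Fin p → ℝ | ∃ S : Finset (Fin p), S.card ≤ s ∧
        ∃ w : EuclideanSpace ℝ S, ‖w‖ = 1 ∧ P (quadRows (fun i (j : S) => x i j) w)}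
      ⊆ ⋃ T ∈ Finset.powersetCard s (Finset.univ : Finset (Fin p)),
        (fun (x : Fin n → Fin p → ℝ) i (j : T) => x i j) ⁻¹'
          {x | ∃ w : EuclideanSpace ℝ T, ‖w‖ = 1 ∧ P (quadRows x w)} := by
    rintro x ⟨S, hS, w, hw, hP⟩
    obtain ⟨T, hST, hT⟩ := Finset.exists_superset_card_eq hS (by simpa using hsp)
    obtain ⟨w', hw', hq⟩ := exists_unit_extend hST x w hw
    simp only [Set.mem_iUnion]
    exact ⟨T, by simp [hT], w', hw', by rw [hq]; exact hP⟩
  calc _ ≤ _ := measure_mono hsub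
    _ ≤ ∑ T ∈ Finset.powersetCard s (Finset.univ : Finset (Fin p)),
        gaussMat n p ((fun (x : Fin n → Fin p → ℝ) i (j : T) => x i j) ⁻¹'
          {x | ∃ w : EuclideanSpace ℝ T, ‖w‖ = 1 ∧ P (quadRows x w)}) :=
      measure_biUnion_finset_le _ _
    _ ≤ ∑ T ∈ Finset.powersetCard s (Finset.univ : Finset (Fin p)), B := by
      refine Finset.sum_le_sum fun T hT => ?_
      have hb : Orthonormal ℝ fun j : T => EuclideanSpace.basisFun (Fin p) ℝ j :=
        (EuclideanSpace.basisFun (Fin p) ℝ).orthonormal.comp _ Subtype.val_injective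
      have hmp := measurePreserving_rows_of_orthonormal n hb
      have hf : (fun (x : Fin n → Fin p → ℝ) i (k : T) =>
          ∑ j, (EuclideanSpace.basisFun (Fin p) ℝ k) j * x i j)
          = fun (x : Fin n → Fin p → ℝ) i (j : T) => x i j := by
        ext x i k
        simp
      rw [hf] at hmp
      refine (Measure.le_map_apply hmp.measurable.aemeasurable _).trans ?_
      refine le_trans (le_of_eq ?_) (hB T (Finset.mem_powersetCard.1 hT).2)
      rw [← hmp.map_eq]
      rfl
    _ = _ := by simp

lemma pow_le_eight_mul_factorial (s : ℕ) : (18 / 5 : ℝ) ^ s ≤ 8 * s.factorial := by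
  rcases lt_or_ge s 3 with h | h
  · interval_cases s <;> norm_num [Nat.factorial]
  · induction s, h using Nat.le_induction with
    | base => norm_num [Nat.factorial]
    | succ s hs ih =>
      rw [pow_succ, Nat.factorial_succ]
      push_cast
      have h4 : (4 : ℝ) ≤ s + 1 := by exact_mod_cast Nat.succ_le_succ hs
      have h0 : (0 : ℝ) ≤ s.factorial := by positivity
      nlinarith

lemma choose_mul_pow_le {p s : ℕ} (hp : 3 ≤ p) (hs : 1 ≤ s) (hsp : s ≤ p)
    (hne : ¬(s = 2 ∧ p ≤ 4)) {B : ℝ} (hB0 : 0 ≤ B) (hB : B ^ 3 * p ^ 4 ≤ 464.76) :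
    p.choose s * B ^ s ≤ 8.2158 := by
  have key : ∀ β : ℝ, 0 ≤ β → 464.76 < β ^ 3 * p ^ 4 → B ≤ β := by
    intro β hβ h
    by_contra! hlt
    have h1 : β ^ 3 ≤ B ^ 3 := by gcongr
    have h2 : β ^ 3 * (p : ℝ) ^ 4 ≤ B ^ 3 * p ^ 4 := by gcongr
    linarith
  rcases le_or_gt 10 p with h10 | h10
  · have hp0 : (10 : ℝ) ≤ p := by exact_mod_cast h10
    have hpB : p * B ≤ 18 / 5 := by
      by_contra! hlt
      have h1 : (18 / 5 : ℝ) ^ 3 ≤ (p * B) ^ 3 := by gcongr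
      have h2 : B ^ 3 * (p : ℝ) ^ 4 = p * (p * B) ^ 3 := by ring
      nlinarith
    have h1 := Nat.choose_le_pow_div (α := ℝ) s p
    have hf : (0 : ℝ) < s.factorial := by positivity
    calc (p.choose s : ℝ) * B ^ s ≤ p ^ s / s.factorial * B ^ s := by gcongr
      _ = (p * B) ^ s / s.factorial := by rw [mul_pow]; ring
      _ ≤ (18 / 5) ^ s / s.factorial := by gcongr
      _ ≤ 8 := (div_le_iff₀ hf).2 (pow_le_eight_mul_factorial s)
      _ ≤ _ := by norm_num
  · have fin : ∀ β : ℝ, 0 ≤ β → 464.76 < β ^ 3 * p ^ 4 → p.choose s * β ^ s ≤ 8.2158 →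
        p.choose s * B ^ s ≤ 8.2158 := by
      intro β hβ h1 h2
      refine le_trans ?_ h2
      gcongr
      exact key β hβ h1
    interval_cases p
    · apply fin 1.791 <;> interval_cases s <;>
        first | exact absurd ⟨rfl, by norm_num⟩ hne | norm_num [Nat.choose]
    · apply fin 1.221 <;> interval_cases s <;>
        first | exact absurd ⟨rfl, by norm_num⟩ hne | norm_num [Nat.choose]
    · apply fin 0.906 <;> interval_cases s <;> norm_num [Nat.choose]
    · apply fin 0.711 <;> interval_cases s <;> norm_num [Nat.choose]
    · apply fin 0.579 <;> interval_cases s <;> norm_num [Nat.choose]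
    · apply fin 0.485 <;> interval_cases s <;> norm_num [Nat.choose]
    · apply fin 0.414 <;> interval_cases s <;> norm_num [Nat.choose]

lemma exp_le_of_le_one_sum {x y : ℝ} (h0 : 0 ≤ x) (h1 : x ≤ 1)
    (h : 1 + x + x ^ 2 / 2 + x ^ 3 / 6 + x ^ 4 * (5 / 96) ≤ y) : exp x ≤ y := by
  have := Real.exp_bound' h0 h1 (n := 4) (by norm_num)
  norm_num [Finset.sum_range_succ, Nat.factorial] at this
  linarith

lemma exp_main_rate : exp (91 / 216) * (√(15 / 2))⁻¹ ≤ exp (-(7 / 12)) := by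
  have hs : 0 < √(15 / 2 : ℝ) := by positivity
  rw [← div_eq_mul_inv, div_le_iff₀ hs, ← div_le_iff₀' (exp_pos _), ← exp_sub]
  apply Real.le_sqrt_of_sq_le
  rw [← Real.exp_nat_mul]
  have h1 : exp (1 / 108) ≤ 1.0095 :=
    exp_le_of_le_one_sum (by norm_num) (by norm_num) (by norm_num)
  have h2 : exp ((2 : ℕ) * (91 / 216 - -(7 / 12))) = exp 1 * exp 1 * exp (1 / 108) := by
    rw [← exp_add, ← exp_add]; congr 1; norm_num
  rw [h2]
  have h3 := exp_one_lt_d9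
  have h4 := exp_pos 1
  calc exp 1 * exp 1 * exp (1 / 108) ≤ 2.7182818286 * 2.7182818286 * 1.0095 := by gcongr
    _ ≤ _ := by norm_num

lemma exp_small_rate : exp (55 / 144) * (√(13 / 2))⁻¹ ≤ 0.738 * exp (-(1 / 4)) := by
  have hs : 0 < √(13 / 2 : ℝ) := by positivity
  have h0 : exp (91 / 144) ≤ 0.738 * √(13 / 2) := by
    rw [← div_le_iff₀' (by norm_num)]
    apply Real.le_sqrt_of_sq_le
    rw [div_pow, ← Real.exp_nat_mul, div_le_iff₀ (by norm_num)]
    have h1 : exp (19 / 72) ≤ 1.30207 :=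
      exp_le_of_le_one_sum (by norm_num) (by norm_num) (by norm_num)
    have h2 : exp ((2 : ℕ) * (91 / 144)) = exp 1 * exp (19 / 72) := by
      rw [← exp_add]; congr 1; norm_num
    rw [h2]
    have h3 := exp_one_lt_d9
    calc exp 1 * exp (19 / 72) ≤ 2.7182818286 * 1.30207 := by gcongr
      _ ≤ _ := by norm_num
  have h5 : exp (91 / 144) = exp (55 / 144) * exp (1 / 4) := by
    rw [← exp_add]; congr 1; norm_num
  rw [h5] at h0
  rw [← div_eq_mul_inv, div_le_iff₀ hs, exp_neg]
  have h6 := exp_pos (1 / 4)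
  calc exp (55 / 144) = exp (55 / 144) * exp (1 / 4) * (exp (1 / 4))⁻¹ := by field_simp
    _ ≤ 0.738 * √(13 / 2) * (exp (1 / 4))⁻¹ := by gcongr
    _ = _ := by ring

lemma inv_pow_sub_pred {K : ℝ} (hK : 0 < K) {n s : ℕ} (hs : 1 ≤ s) (hsn : s ≤ n) :
    (√K)⁻¹ ^ (n - (s - 1)) = √K ^ s * (√K)⁻¹ ^ n * (√K)⁻¹ := by
  have h : 0 < √K := by positivity
  have h1 : n + 1 = (n - (s - 1)) + s := by omega
  rw [mul_assoc, ← pow_succ, h1, pow_add, mul_left_comm, ← mul_pow, mul_inv_cancel₀ h.ne', one_pow,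
    mul_one]

lemma exp_neg_div_le {n p s : ℕ} (hp : 3 ≤ p) (hs : 1 ≤ s)
    (h : 4 * (s : ℝ) * Real.log p ≤ n) : exp (-(n / s : ℝ)) * p ^ 4 ≤ 1 := by
  have hs0 : (0 : ℝ) < s := by exact_mod_cast hs
  have hp0 : (0 : ℝ) < p := by positivity
  have h1 : (p : ℝ) ^ 4 = exp (4 * Real.log p) := by
    rw [mul_comm, Real.exp_mul, Real.exp_log hp0]; norm_num
  rw [h1, ← exp_add, exp_le_one_iff]
  have : 4 * Real.log p ≤ n / s := by rw [le_div_iff₀ hs0]; linarith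
  linarith

lemma one_lt_log {p : ℕ} (hp : 3 ≤ p) : 1 < Real.log p := by
  have hp' : (3 : ℝ) ≤ p := by exact_mod_cast hp
  rw [Real.lt_log_iff_exp_lt (by linarith)]
  linarith [exp_one_lt_d9]

lemma le_of_sample {n p s : ℕ} (hp : 3 ≤ p) (h : 4 * (s : ℝ) * Real.log p ≤ n) : s ≤ n := by
  have h1 := one_lt_log hp
  have h0 : (0 : ℝ) ≤ s := by positivity
  have : (s : ℝ) ≤ n := by nlinarith
  exact_mod_cast this

/-- There are parameters for which the lower-tail bound beats the union bound. -/
lemma exists_lower_tail_parameters {n p s : ℕ} (hs : 1 ≤ s) (hsp : s ≤ p) (hp : 3 ≤ p)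
    (h : 4 * (s : ℝ) * Real.log p ≤ n) :
    ∃ a t : ℝ, 0 < a ∧ a < 1 ∧ 0 ≤ t ∧
      p.choose s * (√((1 + a) / a) ^ s *
        (exp (t * (n / 9 / (1 - a))) * (√(1 + 2 * t))⁻¹ ^ (n - (s - 1)))) ≤ 3 * exp (-n / 4) := by
  have hsn := le_of_sample hp h
  by_cases hne : s = 2 ∧ p ≤ 4
  · refine ⟨1 / 5, 11 / 4, by norm_num, by norm_num, by norm_num, ?_⟩
    obtain ⟨rfl, hp4⟩ := hne
    rw [show (1 + 2 * (11 / 4) : ℝ) = 13 / 2 by norm_num,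
      show ((1 + 1 / 5) / (1 / 5) : ℝ) = 6 by norm_num,
      show (11 / 4 * (n / 9 / (1 - 1 / 5)) : ℝ) = n * (55 / 144) by ring,
      inv_pow_sub_pred (by norm_num) hs hsn, exp_nat_mul,
      show (-n / 4 : ℝ) = n * (-(1 / 4)) by ring, exp_nat_mul, Real.sq_sqrt (by norm_num),
      Real.sq_sqrt (by norm_num)]
    have h1 : (exp (55 / 144) * (√(13 / 2))⁻¹) ^ n ≤ (0.738 * exp (-(1 / 4))) ^ n := by
      exact pow_le_pow_left₀ (by positivity) exp_small_rate n
    rw [mul_pow, mul_pow] at h1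
    have h2 : (√(13 / 2))⁻¹ ≤ 1 / 2.549 := by
      rw [← one_div]
      gcongr
      apply Real.le_sqrt_of_sq_le; norm_num
    have hlog := one_lt_log hp
    have h3 : (p.choose 2 : ℝ) * 39 * (1 / 2.549) * 0.738 ^ n ≤ 3 := by
      interval_cases p
      · have : (8 : ℝ) < n := by push_cast at h hlog; linarith
        have hn9 : 9 ≤ n := by exact_mod_cast this
        have : (0.738 : ℝ) ^ n ≤ 0.738 ^ 9 := pow_le_pow_of_le_one (by norm_num) (by norm_num) hn9
        norm_num [Nat.choose] at this ⊢
        linarith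
      · have h4 : Real.log (4 : ℕ) = 2 * Real.log 2 := by
          rw [show ((4 : ℕ) : ℝ) = 2 ^ 2 by norm_num, Real.log_pow]; norm_num
        rw [h4] at h
        have : (11 : ℝ) < n := by push_cast at h; linarith [Real.log_two_gt_d9]
        have hn9 : 12 ≤ n := by exact_mod_cast this
        have : (0.738 : ℝ) ^ n ≤ 0.738 ^ 12 := pow_le_pow_of_le_one (by norm_num) (by norm_num) hn9
        norm_num [Nat.choose] at this ⊢
        linarith
    calc _ = (p.choose 2 : ℝ) * 39 * (√(13 / 2))⁻¹ * (exp (55 / 144) ^ n * (√(13 / 2))⁻¹ ^ n) := by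
          ring
      _ ≤ (p.choose 2 : ℝ) * 39 * (1 / 2.549) * (0.738 ^ n * exp (-(1 / 4)) ^ n) := by gcongr
      _ = (p.choose 2 : ℝ) * 39 * (1 / 2.549) * 0.738 ^ n * exp (-(1 / 4)) ^ n := by ring
      _ ≤ _ := by gcongr
  · refine ⟨1 / 7, 13 / 4, by norm_num, by norm_num, by norm_num, ?_⟩
    rw [show (1 + 2 * (13 / 4) : ℝ) = 15 / 2 by norm_num,
      show ((1 + 1 / 7) / (1 / 7) : ℝ) = 8 by norm_num,
      show (13 / 4 * (n / 9 / (1 - 1 / 7)) : ℝ) = n * (91 / 216) by ring,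
      inv_pow_sub_pred (by norm_num) hs hsn, exp_nat_mul]
    have h1 : (exp (91 / 216) * (√(15 / 2))⁻¹) ^ n ≤ exp (-(7 / 12)) ^ n := by
      gcongr
      exact exp_main_rate
    rw [mul_pow] at h1
    have h2 : (√(15 / 2))⁻¹ ≤ 1 / 2.7386 := by
      rw [← one_div]
      gcongr
      apply Real.le_sqrt_of_sq_le; norm_num
    set B : ℝ := √60 * exp (-(n / (3 * s))) with hBdef
    have hB : √8 ^ s * √(15 / 2) ^ s * exp (-(7 / 12)) ^ n = B ^ s * exp (-n / 4) := by
      rw [hBdef, ← mul_pow, ← Real.sqrt_mul (by norm_num), mul_pow, ← exp_nat_mul, ← exp_nat_mul,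
        mul_assoc, ← exp_add]
      congr 2
      · norm_num
      · field_simp; ring
    have hB3 : B ^ 3 * p ^ 4 ≤ 464.76 := by
      have h60 : √60 ^ 3 ≤ 464.76 := by
        have h6 : √60 ≤ 7.746 := Real.sqrt_le_iff.2 ⟨by norm_num, by norm_num⟩
        have h7 := Real.sq_sqrt (show (0 : ℝ) ≤ 60 by norm_num)
        rw [pow_succ, h7]
        linarith
      have he : exp (-(n / (3 * s) : ℝ)) ^ 3 = exp (-(n / s : ℝ)) := by
        rw [← exp_nat_mul]
        congr 1
        push_cast
        field_simp
      rw [hBdef, mul_pow, he, mul_assoc]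
      have h8 := exp_neg_div_le hp hs h
      calc √60 ^ 3 * (exp (-(n / s : ℝ)) * p ^ 4) ≤ 464.76 * 1 := by gcongr
        _ = _ := by norm_num
    have h5 := choose_mul_pow_le hp hs hsp hne (B := B) (by positivity) hB3
    calc _ = (p.choose s : ℝ) * (√(15 / 2))⁻¹ * (√8 ^ s * √(15 / 2) ^ s *
            (exp (91 / 216) ^ n * (√(15 / 2))⁻¹ ^ n)) := by ring
      _ ≤ (p.choose s : ℝ) * (1 / 2.7386) * (√8 ^ s * √(15 / 2) ^ s * exp (-(7 / 12)) ^ n) := by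
          gcongr
      _ = (p.choose s * B ^ s) * (1 / 2.7386) * exp (-n / 4) := by rw [hB]; ring
      _ ≤ 8.2158 * (1 / 2.7386) * exp (-n / 4) := by gcongr
      _ ≤ _ := by gcongr; norm_num

lemma upper_tail_union_le {n p s : ℕ} (hp : 3 ≤ p)
    (h : 4 * (s : ℝ) * Real.log p ≤ n) :
    p.choose s * (2 * 3 ^ s * (2 * exp (-(3 / 2))) ^ n) ≤ 3 * exp (-n / 4) := by
  have hp0 : (0 : ℝ) < p := by positivity
  have hps : (p : ℝ) ^ s ≤ exp (n / 4) := by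
    rw [← Real.exp_log hp0, ← exp_nat_mul, exp_le_exp]
    linarith
  have h3 : (3 : ℝ) ^ s ≤ exp (n / 4) := by
    refine le_trans ?_ hps
    gcongr
    exact_mod_cast hp
  have hc : (p.choose s : ℝ) ≤ exp (n / 4) := by
    refine le_trans ?_ hps
    exact_mod_cast Nat.choose_le_pow p s
  have h2 : (2 * exp (-(3 / 2))) ^ n ≤ exp (-(3 / 4) * n) := by
    have h4 : (2 : ℝ) ≤ exp (3 / 4) := by
      rw [← Real.log_le_iff_le_exp (by norm_num)]
      linarith [Real.log_two_lt_d9]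
    calc (2 * exp (-(3 / 2))) ^ n ≤ (exp (3 / 4) * exp (-(3 / 2))) ^ n := by gcongr
      _ = _ := by
        rw [← exp_add, ← exp_nat_mul]
        congr 1
        ring
  calc _ ≤ exp (n / 4) * (2 * exp (n / 4) * exp (-(3 / 4) * n)) := by gcongr
    _ = 2 * exp (-n / 4) := by
      rw [mul_assoc 2, mul_left_comm, ← exp_add, ← exp_add]
      congr 2
      ring
    _ ≤ _ := by gcongr; norm_num

/-- uniform two-sided eigenvalue bounds for Gaussian Gram matrices. -/
theorem stmt_5 (n p sstar : ℕ) (hn : 1 ≤ n) (hs : 1 ≤ sstar) (hsp : sstar ≤ p)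
    (hp : 3 ≤ p) (hsample : 4 * (sstar : ℝ) * Real.log p ≤ (n : ℝ)) :
    gaussMat n p {x | ∃ S : Finset (Fin p), S.Nonempty ∧ S.card ≤ sstar ∧
        lamMin (gramW S (fun _ => 1) x) ≤ (n : ℝ) / 9}
      ≤ ENNReal.ofReal (3 * Real.exp (-(n : ℝ) / 4)) ∧
    gaussMat n p {x | ∃ S : Finset (Fin p), S.Nonempty ∧ S.card ≤ sstar ∧
        9 * (n : ℝ) ≤ lamMax (gramW S (fun _ => 1) x)}
      ≤ ENNReal.ofReal (3 * Real.exp (-(n : ℝ) / 4)) := by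
  have hn' : (0 : ℝ) < n := by exact_mod_cast hn
  have hT : ∀ T : Finset (Fin p), T.card = sstar → Nonempty T := fun T hT =>
    (Finset.card_pos.1 (by omega)).to_subtype
  constructor
  · obtain ⟨a, t, ha0, ha1, ht, hnum⟩ := exists_lower_tail_parameters hs hsp hp hsample
    refine le_trans (measure_mono ?_) (le_trans (gaussMat_union_bound hsp
      (P := fun r => r ≤ (n : ℝ) / 9)
      (B := ENNReal.ofReal (√((1 + a) / a) ^ sstar *
        (exp (t * (n / 9 / (1 - a))) * (√(1 + 2 * t))⁻¹ ^ (n - (sstar - 1))))) fun T hTs => ?_) ?_)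
    · rintro x ⟨S, hS, hcard, hx⟩
      have := hS.to_subtype
      obtain ⟨u, hu, hmin⟩ := lamMin_mem (gramW S (fun _ => 1) x)
      rw [hmin, dotProduct_gramW_mulVec] at hx
      exact ⟨S, hcard, u, hu, hx⟩
    · have := hT T hTs
      have h := exists_unit_quadRows_le (ι := T) n ha0 ha1 ht (show (0 : ℝ) < n / 9 by positivity)
      rwa [Fintype.card_coe, hTs] at h
    · rw [← ENNReal.ofReal_natCast, ← ENNReal.ofReal_mul (by positivity)]
      exact ENNReal.ofReal_le_ofReal hnum
  · refine le_trans (measure_mono ?_) (le_trans (gaussMat_union_bound hsp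
      (P := fun r => 9 * (n : ℝ) ≤ r)
      (B := ENNReal.ofReal (2 * 3 ^ sstar * (2 * exp (-(3 / 2))) ^ n)) fun T hTs => ?_) ?_)
    · rintro x ⟨S, hS, hcard, hx⟩
      have := hS.to_subtype
      obtain ⟨u, hu, hmax⟩ := lamMax_mem (gramW S (fun _ => 1) x)
      rw [hmax, dotProduct_gramW_mulVec] at hx
      exact ⟨S, hcard, u, hu, hx⟩
    · have := hT T hTs
      have h := exists_unit_quadRows_ge (ι := T) n hn
      rwa [Fintype.card_coe, hTs] at h
    · rw [← ENNReal.ofReal_natCast, ← ENNReal.ofReal_mul (by positivity)]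
      exact ENNReal.ofReal_le_ofReal (upper_tail_union_le hp hsample)
end

section
/- Suppose (s⋆·log p)^{3/2} ≤ n and p ≥ 12. There exists a universal constant K̃ > 0 (not depending on n, p, or s⋆) such that P(max_{S ∈ 𝒮_{s⋆}} sup_{u ∈ ℝ^{|S|}, ‖u‖₂ = 1} n^{−1}·∑_{i=1}^n |X_{i,S}ᵀu|³ ≤ K̃) ≥ 1 − 6·p^{−s⋆}. -/
open MeasureTheory ProbabilityTheory Real

theorem integrable_abs_cube_mul_exp_sq_gaussianReal :
    Integrable (fun x : ℝ => |x| ^ 3 * exp (x ^ 2 / 4)) (gaussianReal 0 1) := by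
  rw [gaussianReal_of_var_ne_zero 0 one_ne_zero,
    integrable_withDensity_iff_integrable_smul' (measurable_gaussianPDF 0 1)
      (ae_of_all _ fun _ => gaussianPDF_lt_top)]
  have h := ((integrable_rpow_mul_exp_neg_mul_sq (b := 1 / 4) (by norm_num)
    (s := 3) (by norm_num)).abs).const_mul ((√(2 * π * 1))⁻¹)
  refine h.congr (ae_of_all _ fun x => ?_)
  have h3 : x ^ (3 : ℝ) = x ^ 3 := by exact_mod_cast rpow_natCast x 3
  simp only [toReal_gaussianPDF, gaussianPDFReal_def, smul_eq_mul, sub_zero, NNReal.coe_one,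
    abs_mul, abs_exp, h3, abs_pow]
  have : exp (-(1 / 4) * x ^ 2) = exp (-x ^ 2 / (2 * 1)) * exp (x ^ 2 / 4) := by
    rw [← exp_add]; ring_nf
  rw [this]
  ring

theorem gaussianReal_abs_ge_le {t : ℝ} (ht : 0 ≤ t) :
    (gaussianReal 0 1).real {x | t ≤ |x|} ≤ 2 * exp (-t ^ 2 / 2) := by
  have hsub : HasSubgaussianMGF (fun x : ℝ => x) 1 (gaussianReal 0 1) :=
    ⟨fun t => integrable_exp_mul_gaussianReal t, fun t => by
      rw [mgf_gaussianReal (μ := 0) (v := 1) Measure.map_id']; simp⟩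
  have h1 := hsub.measure_ge_le ht
  have h2 := hsub.neg.measure_ge_le ht
  have hset : {x : ℝ | t ≤ |x|} = {x | t ≤ x} ∪ {x | t ≤ (-fun x : ℝ => x) x} := by
    ext x; simp [le_abs]
  rw [hset]
  refine (measureReal_union_le _ _).trans ?_
  simp only [NNReal.coe_one, mul_one] at h1 h2
  linarith

/-- A truncation of `|x| ^ 3` which agrees with it for `|x| ≤ b`. -/
noncomputable def truncCube (b x : ℝ) : ℝ := min (|x| ^ 3) (b * x ^ 2)

theorem truncCube_of_abs_le {b x : ℝ} (h : |x| ≤ b) : truncCube b x = |x| ^ 3 := by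
  rw [truncCube, min_eq_left]
  rw [← sq_abs x]
  nlinarith [sq_nonneg |x|]

theorem measurable_truncCube (b : ℝ) : Measurable (truncCube b) := by
  unfold truncCube; fun_prop

theorem exp_truncCube_le {b l : ℝ} (hl : 0 ≤ l) (hbl : l * b ≤ 1 / 4) (x : ℝ) :
    exp (l * truncCube b x) ≤ 1 + l * (|x| ^ 3 * exp (x ^ 2 / 4)) := by
  set y := truncCube b x
  have hy1 : y ≤ |x| ^ 3 := min_le_left _ _
  have hy2 : l * y ≤ x ^ 2 / 4 := by
    have : y ≤ b * x ^ 2 := min_le_right _ _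
    nlinarith [sq_nonneg x]
  have h1 : exp (l * y) ≤ 1 + l * y * exp (l * y) := by
    have := add_one_le_exp (-(l * y))
    have h2 : exp (-(l * y)) * exp (l * y) = 1 := by rw [← exp_add]; simp
    nlinarith [exp_pos (l * y)]
  refine h1.trans ?_
  have h3 : exp (l * y) ≤ exp (x ^ 2 / 4) := exp_le_exp.2 hy2
  have h4 : y * exp (l * y) ≤ |x| ^ 3 * exp (x ^ 2 / 4) :=
    mul_le_mul hy1 h3 (exp_pos _).le (by positivity)
  nlinarith

theorem integrable_exp_truncCube {b l : ℝ} (hl : 0 ≤ l) (hbl : l * b ≤ 1 / 4) :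
    Integrable (fun x => exp (l * truncCube b x)) (gaussianReal 0 1) := by
  refine Integrable.mono' ((integrable_const (1 : ℝ)).add
    (integrable_abs_cube_mul_exp_sq_gaussianReal.const_mul l)) ?_ (ae_of_all _ fun x => ?_)
  · exact (((measurable_truncCube b).const_mul l).exp).aestronglyMeasurable
  · rw [norm_eq_abs, abs_exp]
    exact exp_truncCube_le hl hbl x

theorem gaussian_sum_truncCube_ge_le (n : ℕ) {b l : ℝ} (hl : 0 ≤ l) (hbl : l * b ≤ 1 / 4)
    (a : ℝ) :
    (Measure.pi fun _ : Fin n => gaussianReal 0 1).real {g | a ≤ ∑ i, truncCube b (g i)} ≤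
      exp (-l * a) * exp (n * (l * ∫ x, |x| ^ 3 * exp (x ^ 2 / 4) ∂(gaussianReal 0 1))) := by
  have hprod : ∀ g : Fin n → ℝ,
      exp (l * ∑ i, truncCube b (g i)) = ∏ i, exp (l * truncCube b (g i)) := fun g => by
    rw [Finset.mul_sum, exp_sum]
  have hint : Integrable (fun g : Fin n → ℝ => exp (l * ∑ i, truncCube b (g i)))
      (Measure.pi fun _ : Fin n => gaussianReal 0 1) := by
    simp_rw [hprod]
    exact Integrable.fintype_prod (f := fun _ x => exp (l * truncCube b x))
      fun _ => integrable_exp_truncCube hl hbl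
  refine (measure_ge_le_exp_mul_mgf a hl hint).trans ?_
  gcongr
  simp only [mgf, hprod]
  rw [integral_fintype_prod_eq_pow (fun x => exp (l * truncCube b x)), Fintype.card_fin, exp_nat_mul]
  refine pow_le_pow_left₀ (integral_nonneg fun x => (exp_pos _).le) ?_ n
  calc ∫ x, exp (l * truncCube b x) ∂(gaussianReal 0 1)
      ≤ ∫ x, (1 + l * (|x| ^ 3 * exp (x ^ 2 / 4))) ∂(gaussianReal 0 1) :=
        integral_mono (integrable_exp_truncCube hl hbl) ((integrable_const (1 : ℝ)).add
          (integrable_abs_cube_mul_exp_sq_gaussianReal.const_mul l)) (exp_truncCube_le hl hbl)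
    _ = 1 + l * ∫ x, |x| ^ 3 * exp (x ^ 2 / 4) ∂(gaussianReal 0 1) := by
        rw [integral_add (integrable_const _)
          (integrable_abs_cube_mul_exp_sq_gaussianReal.const_mul l), integral_const_mul]
        simp
    _ ≤ _ := by
        rw [add_comm]; exact add_one_le_exp _

theorem gaussian_exists_abs_ge_le (n : ℕ) {t : ℝ} (ht : 0 ≤ t) :
    (Measure.pi fun _ : Fin n => gaussianReal 0 1).real {g | ∃ i, t ≤ |g i|} ≤
      n * (2 * exp (-t ^ 2 / 2)) := by
  have hset : {g : Fin n → ℝ | ∃ i, t ≤ |g i|} = ⋃ i, {g | t ≤ |g i|} := by ext; simp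
  rw [hset]
  refine (measureReal_iUnion_fintype_le _).trans ?_
  refine (Finset.sum_le_card_nsmul _ _ (2 * exp (-t ^ 2 / 2)) fun i _ => ?_).trans (by simp)
  refine le_of_eq_of_le ?_ (gaussianReal_abs_ge_le ht)
  exact (measurePreserving_eval (fun _ : Fin n => gaussianReal 0 1) i).measureReal_preimage
    (s := {x | t ≤ |x|}) (measurableSet_le measurable_const (by fun_prop)).nullMeasurableSet

theorem exists_gaussian_sum_abs_cube_gt_le : ∃ K : ℝ, 0 < K ∧ ∀ (n : ℕ) (m : ℝ), 1 ≤ m →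
    (n : ℝ) = m ^ 3 →
    (Measure.pi fun _ : Fin n => gaussianReal 0 1).real {g | K * n < ∑ i, |g i| ^ 3} ≤
      3 * exp (-4 * m ^ 2) := by
  set A := ∫ x, |x| ^ 3 * exp (x ^ 2 / 4) ∂(gaussianReal 0 1) with hA
  have hA0 : 0 ≤ A := integral_nonneg fun x => by positivity
  refine ⟨A + 64, by positivity, fun n m hm hn => ?_⟩
  have hm0 : 0 < m := by linarith
  have hsub : {g : Fin n → ℝ | (A + 64) * n < ∑ i, |g i| ^ 3} ⊆
      {g | ∃ i, 4 * m ≤ |g i|} ∪ {g | (A + 64) * n ≤ ∑ i, truncCube (4 * m) (g i)} := by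
    intro g hg
    by_cases h : ∃ i, 4 * m ≤ |g i|
    · exact Or.inl h
    · push Not at h
      refine Or.inr ?_
      simp only [Set.mem_ofPred_eq] at hg ⊢
      rw [Finset.sum_congr rfl fun i _ => truncCube_of_abs_le (h i).le]
      exact hg.le
  refine (measureReal_mono hsub).trans ((measureReal_union_le _ _).trans ?_)
  have h1 := gaussian_exists_abs_ge_le n (t := 4 * m) (by positivity)
  have h2 := gaussian_sum_truncCube_ge_le n (b := 4 * m) (l := 1 / (16 * m)) (by positivity)
    (by apply le_of_eq; field_simp; norm_num) ((A + 64) * n)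
  have e2 : exp (-(1 / (16 * m)) * ((A + 64) * n)) * exp (n * (1 / (16 * m) * A)) =
      exp (-4 * m ^ 2) := by
    rw [← exp_add, hn]; congr 1; field_simp; ring
  rw [← hA, e2] at h2
  have h3 : (n : ℝ) ≤ exp (4 * m ^ 2) := by
    have : m ≤ exp m := by linarith [add_one_le_exp m]
    calc (n : ℝ) = m ^ 3 := hn
      _ ≤ exp m ^ 3 := by gcongr
      _ = exp (3 * m) := by rw [← exp_nat_mul]; norm_num
      _ ≤ _ := by gcongr exp ?_; nlinarith
  have h4 : n * (2 * exp (-(4 * m) ^ 2 / 2)) ≤ 2 * exp (-4 * m ^ 2) := by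
    calc n * (2 * exp (-(4 * m) ^ 2 / 2)) ≤ exp (4 * m ^ 2) * (2 * exp (-(4 * m) ^ 2 / 2)) := by
          gcongr
      _ = 2 * exp (-4 * m ^ 2) := by
          rw [mul_left_comm, ← exp_add]; ring_nf
  linarith

theorem map_sum_mul_pi_gaussianReal {ι : Type*} [Fintype ι] (a : ι → ℝ) :
    (Measure.pi fun _ : ι => gaussianReal 0 1).map (fun x => ∑ j, x j * a j) =
      gaussianReal 0 (∑ j, a j ^ 2).toNNReal := by
  have hmeas : Measurable fun x : ι → ℝ => ∑ j, x j * a j := by fun_prop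
  have : IsProbabilityMeasure
      ((Measure.pi fun _ : ι => gaussianReal 0 1).map (fun x => ∑ j, x j * a j)) :=
    Measure.isProbabilityMeasure_map hmeas.aemeasurable
  refine Measure.ext_of_charFun (funext fun t => ?_)
  rw [charFun_apply_real, integral_map hmeas.aemeasurable (by fun_prop), charFun_gaussianReal]
  have h : ∀ x : ι → ℝ, Complex.exp (t * ((∑ j, x j * a j : ℝ) : ℂ) * Complex.I) =
      ∏ j, Complex.exp (((t * a j : ℝ) : ℂ) * x j * Complex.I) := fun x => by
    rw [← Complex.exp_sum]
    push_cast
    rw [Finset.mul_sum, Finset.sum_mul]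
    congr 1
    exact Finset.sum_congr rfl fun j _ => by ring
  simp_rw [h]
  rw [integral_fintype_prod_eq_prod
    (fun j (x : ℝ) => Complex.exp (((t * a j : ℝ) : ℂ) * x * Complex.I))]
  simp_rw [← charFun_apply_real, charFun_gaussianReal]
  rw [← Complex.exp_sum, Real.coe_toNNReal _ (by positivity)]
  congr 1
  push_cast
  simp only [mul_zero, zero_mul, zero_sub, one_mul]
  rw [Finset.sum_neg_distrib, Finset.sum_mul, Finset.sum_div]
  exact congrArg _ (Finset.sum_congr rfl fun j _ => by ring)

theorem map_sum_mul_gaussMat (n p : ℕ) (a : Fin p → ℝ) :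
    (gaussMat n p).map (fun x i => ∑ j, x i j * a j) =
      (Measure.pi fun _ : Fin n => gaussianReal 0 1).map (fun g i => √(∑ j, a j ^ 2) * g i) := by
  have hmeas : Measurable fun x : Fin p → ℝ => ∑ j, x j * a j := by fun_prop
  have h1 : (gaussianReal 0 1).map (fun x => √(∑ j, a j ^ 2) * x) =
      gaussianReal 0 (∑ j, a j ^ 2).toNNReal := by
    rw [gaussianReal_map_const_mul]
    congr 1
    · simp
    · ext
      simp [Real.sq_sqrt, Finset.sum_nonneg, sq_nonneg]
  have : IsProbabilityMeasure ((Measure.pi fun _ : Fin p => gaussianReal 0 1).map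
      (fun x => ∑ j, x j * a j)) := Measure.isProbabilityMeasure_map hmeas.aemeasurable
  have : IsProbabilityMeasure ((gaussianReal 0 1).map (fun x => √(∑ j, a j ^ 2) * x)) := by
    rw [h1]; infer_instance
  rw [gaussMat, Measure.pi_map_pi (f := fun _ : Fin n => fun x : Fin p → ℝ => ∑ j, x j * a j)
      fun _ => hmeas.aemeasurable,
    Measure.pi_map_pi (f := fun _ : Fin n => fun x : ℝ => √(∑ j, a j ^ 2) * x)
      fun _ => by fun_prop]
  simp_rw [h1, map_sum_mul_pi_gaussianReal]

theorem gaussMat_sum_abs_cube_gt_le (n p : ℕ) (a : Fin p → ℝ) (ha : ∑ j, a j ^ 2 ≤ 1) (c : ℝ) :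
    (gaussMat n p).real {x | c < ∑ i, |∑ j, x i j * a j| ^ 3} ≤
      (Measure.pi fun _ : Fin n => gaussianReal 0 1).real {g | c < ∑ i, |g i| ^ 3} := by
  have hms : MeasurableSet {g : Fin n → ℝ | c < ∑ i, |g i| ^ 3} :=
    measurableSet_lt measurable_const (by fun_prop)
  have h := congrArg (fun μ : Measure (Fin n → ℝ) => μ.real {g | c < ∑ i, |g i| ^ 3})
    (map_sum_mul_gaussMat n p a)
  rw [map_measureReal_apply (by fun_prop) hms, map_measureReal_apply (by fun_prop) hms] at h
  refine h.le.trans (measureReal_mono fun g hg => ?_)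
  simp only [Set.mem_preimage, Set.mem_ofPred_eq] at hg ⊢
  refine hg.trans_le (Finset.sum_le_sum fun i _ => ?_)
  refine pow_le_pow_left₀ (abs_nonneg _) ?_ 3
  rw [abs_mul, abs_of_nonneg (sqrt_nonneg _)]
  exact mul_le_of_le_one_left (abs_nonneg _) (sqrt_le_one.2 ha)

theorem gaussMat_sum_abs_cube_comp_gt_le {n p s : ℕ} {σ : Fin s → Fin p}
    (hσ : Function.Injective σ) (v : Fin s → ℝ) (hv : ∑ j, v j ^ 2 ≤ 1) (c : ℝ) :
    (gaussMat n p).real {x | c < ∑ i, |∑ j, x i (σ j) * v j| ^ 3} ≤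
      (Measure.pi fun _ : Fin n => gaussianReal 0 1).real {g | c < ∑ i, |g i| ^ 3} := by
  set a : Fin p → ℝ := Function.extend σ v 0
  have ha0 : ∀ k, k ∉ Set.range σ → a k = 0 := fun k hk => Function.extend_apply' _ _ _ hk
  have ha1 : ∀ j, a (σ j) = v j := fun j => hσ.extend_apply _ _ _
  have hsum : ∀ y : Fin p → ℝ, ∑ j, y (σ j) * v j = ∑ k, y k * a k := fun y =>
    Fintype.sum_of_injective σ hσ _ _ (fun k hk => by simp [ha0 k hk]) fun j => by rw [ha1]
  have hsq : ∑ j, v j ^ 2 = ∑ k, a k ^ 2 :=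
    Fintype.sum_of_injective σ hσ _ _ (fun k hk => by simp [ha0 k hk]) fun j => by rw [ha1]
  simp_rw [hsum]
  exact gaussMat_sum_abs_cube_gt_le n p a (hsq ▸ hv) c

/-- The `k`-th point of the uniform grid of `[-1, 1]` with mesh `1 / p`. -/
noncomputable def gridPoint (p : ℕ) (k : Fin (2 * p + 1)) : ℝ := ((k : ℝ) - p) / p

theorem exists_gridPoint_near {p : ℕ} (hp : 0 < p) {w : ℝ} (hw : |w| ≤ 1) :
    ∃ k, |gridPoint p k| ≤ |w| ∧ |w - gridPoint p k| ≤ 1 / p := by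
  have hp' : (0 : ℝ) < p := by exact_mod_cast hp
  set m := ⌊|w| * p⌋₊
  have hm1 : (m : ℝ) ≤ |w| * p := Nat.floor_le (by positivity)
  have hm2 : |w| * p < m + 1 := Nat.lt_floor_add_one _
  have hmp : m ≤ p := by
    have : (m : ℝ) ≤ p := by nlinarith
    exact_mod_cast this
  have h1 : (m : ℝ) / p ≤ |w| := by rwa [div_le_iff₀ hp']
  have h2 : |w| - m / p ≤ 1 / p := by
    rw [sub_le_iff_le_add, ← add_div, le_div_iff₀ hp']; linarith
  have h0 : (0 : ℝ) ≤ m / p := by positivity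
  rcases le_total 0 w with h | h
  · refine ⟨⟨p + m, by omega⟩, ?_⟩
    have e : gridPoint p ⟨p + m, by omega⟩ = m / p := by simp [gridPoint]
    rw [abs_of_nonneg h] at *
    rw [e, abs_of_nonneg h0, abs_of_nonneg (by linarith)]
    exact ⟨h1, h2⟩
  · refine ⟨⟨p - m, by omega⟩, ?_⟩
    have e : gridPoint p ⟨p - m, by omega⟩ = -(m / p) := by
      simp [gridPoint, Nat.cast_sub hmp, neg_div]
    rw [abs_of_nonpos h] at *
    rw [e, abs_neg, abs_of_nonneg h0, abs_of_nonpos (by linarith)]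
    exact ⟨h1, by linarith⟩

theorem exists_gridPoint_sum_sq_sub_le {p s : ℕ} (hsp : s ≤ p) (hp : 4 ≤ p) {w : Fin s → ℝ}
    (hw : ∑ j, w j ^ 2 ≤ 1) :
    ∃ k : Fin s → Fin (2 * p + 1), ∑ j, gridPoint p (k j) ^ 2 ≤ 1 ∧
      ∑ j, (w j - gridPoint p (k j)) ^ 2 ≤ (1 / 2) ^ 2 := by
  have hp' : (4 : ℝ) ≤ p := by exact_mod_cast hp
  have hsp' : (s : ℝ) ≤ p := by exact_mod_cast hsp
  have hw1 : ∀ j, |w j| ≤ 1 := fun j => by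
    rw [← sq_le_one_iff_abs_le_one]
    exact (Finset.single_le_sum (f := fun j => w j ^ 2) (fun i _ => sq_nonneg _)
      (Finset.mem_univ j)).trans hw
  choose k hk1 hk2 using fun j => exists_gridPoint_near (by omega : 0 < p) (hw1 j)
  refine ⟨k, (Finset.sum_le_sum fun j _ => sq_le_sq.2 (hk1 j)).trans hw, ?_⟩
  calc ∑ j, (w j - gridPoint p (k j)) ^ 2 ≤ ∑ _j : Fin s, (1 / (p : ℝ)) ^ 2 :=
        Finset.sum_le_sum fun j _ => sq_le_sq.2 ((hk2 j).trans (le_abs_self _))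
    _ = s * (1 / (p : ℝ)) ^ 2 := by simp
    _ ≤ p * (1 / (p : ℝ)) ^ 2 := by gcongr
    _ = 1 / p := by field_simp
    _ ≤ 1 / 4 := by gcongr
    _ = _ := by norm_num

theorem norm_apply_le_of_half_net {E F : Type*} [NormedAddCommGroup E] [NormedSpace ℝ E]
    [NormedAddCommGroup F] [NormedSpace ℝ F] (f : E →L[ℝ] F) {T : ℝ} (hT : 0 ≤ T)
    (h : ∀ w : E, ‖w‖ ≤ 1 → ∃ v, ‖f v‖ ≤ T ∧ ‖w - v‖ ≤ 1 / 2) {w : E} (hw : ‖w‖ ≤ 1) :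
    ‖f w‖ ≤ 2 * T := by
  have hf : ‖f‖ ≤ T + ‖f‖ * (1 / 2) :=
    f.opNorm_le_of_unit_norm (by positivity) fun w hw => by
      obtain ⟨v, hv, hwv⟩ := h w hw.le
      calc ‖f w‖ = ‖f v + f (w - v)‖ := by rw [← map_add]; simp
        _ ≤ ‖f v‖ + ‖f (w - v)‖ := norm_add_le _ _
        _ ≤ T + ‖f‖ * (1 / 2) := add_le_add hv ((f.le_opNorm _).trans (by gcongr))
  have := (f.le_opNorm w).trans (mul_le_of_le_one_right (norm_nonneg f) hw)
  linarith

theorem sum_abs_cube_le_of_grid {n p s : ℕ} (hsp : s ≤ p) (hp : 4 ≤ p) (x : Fin n → Fin s → ℝ)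
    {T : ℝ} (hT : 0 ≤ T)
    (h : ∀ k : Fin s → Fin (2 * p + 1), ∑ j, gridPoint p (k j) ^ 2 ≤ 1 →
      ∑ i, |∑ j, x i j * gridPoint p (k j)| ^ 3 ≤ T ^ 3)
    {w : Fin s → ℝ} (hw : ∑ j, w j ^ 2 ≤ 1) :
    ∑ i, |∑ j, x i j * w j| ^ 3 ≤ (2 * T) ^ 3 := by
  have : Fact (1 ≤ (3 : ENNReal)) := ⟨by norm_num⟩
  let f : EuclideanSpace ℝ (Fin s) →L[ℝ] PiLp 3 fun _ : Fin n => ℝ := LinearMap.toContinuousLinearMap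
    { toFun := fun w => WithLp.toLp 3 fun i => ∑ j, x i j * w j
      map_add' := fun v w => by
        ext i; simp [mul_add, Finset.sum_add_distrib]
      map_smul' := fun c w => by
        ext i; simp [Finset.mul_sum, mul_left_comm] }
  have hf : ∀ w, ‖f w‖ ^ 3 = ∑ i, |∑ j, x i j * w j| ^ 3 := fun w => by
    rw [PiLp.norm_eq_sum (by norm_num), ← rpow_natCast, ← rpow_mul (by positivity)]
    norm_num [f]
  have hnorm : ∀ (w : EuclideanSpace ℝ (Fin s)) (r : ℝ), 0 ≤ r →
      (‖w‖ ≤ r ↔ ∑ j, w j ^ 2 ≤ r ^ 2) := fun w r hr => by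
    rw [← EuclideanSpace.real_norm_sq_eq, sq_le_sq₀ (norm_nonneg _) hr]
  have key := norm_apply_le_of_half_net f hT (w := WithLp.toLp 2 w) (fun w hw => by
    rw [hnorm _ _ zero_le_one, one_pow] at hw
    obtain ⟨k, hk1, hk2⟩ := exists_gridPoint_sum_sq_sub_le hsp hp hw
    refine ⟨WithLp.toLp 2 fun j => gridPoint p (k j), ?_, ?_⟩
    · rw [← pow_le_pow_iff_left₀ (norm_nonneg _) hT three_ne_zero, hf]
      exact h k hk1
    · rw [hnorm _ _ (by norm_num)]
      exact hk2) (by rw [hnorm _ _ zero_le_one, one_pow]; exact hw)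
  rw [← pow_le_pow_iff_left₀ (norm_nonneg _) (by positivity) three_ne_zero, hf] at key
  exact key

theorem exists_injective_sum_extension {p s : ℕ} (hsp : s ≤ p) {S : Finset (Fin p)}
    (hS : S.card ≤ s) (u : S → ℝ) :
    ∃ (σ : Fin s → Fin p) (w : Fin s → ℝ), Function.Injective σ ∧
      ∑ j, w j ^ 2 = ∑ j, u j ^ 2 ∧
      ∀ y : Fin p → ℝ, ∑ j : S, y j.1 * u j = ∑ j, y (σ j) * w j := by
  obtain ⟨T, hST, hT⟩ := Finset.exists_superset_card_eq hS (by simpa using hsp)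
  let e : S → Fin s := fun j => (T.orderIsoOfFin hT).symm ⟨j, hST j.2⟩
  have he : Function.Injective e := fun i j hij => by
    simpa only [Subtype.ext_iff] using (T.orderIsoOfFin hT).symm.injective hij
  have hσe : ∀ j, T.orderEmbOfFin hT (e j) = j := fun j => by
    rw [← Finset.coe_orderIsoOfFin_apply, OrderIso.apply_symm_apply]
  have hw0 : ∀ k, k ∉ Set.range e → Function.extend e u 0 k = 0 :=
    fun k hk => Function.extend_apply' _ _ _ hk
  refine ⟨T.orderEmbOfFin hT, Function.extend e u 0, (T.orderEmbOfFin hT).injective, ?_,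
    fun y => ?_⟩
  · exact (Fintype.sum_of_injective e he _ _ (fun k hk => by simp [hw0 k hk])
      fun j => by rw [he.extend_apply]).symm
  · exact Fintype.sum_of_injective e he _ _ (fun k hk => by simp [hw0 k hk])
      fun j => by rw [he.extend_apply, hσe]

/-- uniform bound on averaged cubes of sparse marginals of a standard
Gaussian matrix. -/
theorem stmt_8 : ∃ K : ℝ, 0 < K ∧
    ∀ n p sstar : ℕ, 1 ≤ n → 1 ≤ sstar → sstar ≤ p → 12 ≤ p →
      ((sstar : ℝ) * Real.log p) ^ ((3 : ℝ) / 2) ≤ (n : ℝ) →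
      1 - ENNReal.ofReal (6 * (p : ℝ) ^ (-(sstar : ℝ))) ≤
        gaussMat n p {x | ∀ S : Finset (Fin p), S.Nonempty → S.card ≤ sstar →
          ∀ u : S → ℝ, (∑ j, u j ^ 2) = 1 →
            (n : ℝ)⁻¹ * ∑ i, |∑ j : S, x i j.1 * u j| ^ 3 ≤ K} := by
  obtain ⟨K, hK, htail⟩ := exists_gaussian_sum_abs_cube_gt_le
  refine ⟨8 * K, by positivity, fun n p s hn _ hsp hp hlog => ?_⟩
  have hn' : (1 : ℝ) ≤ n := by exact_mod_cast hn
  have hp' : (12 : ℝ) ≤ p := by exact_mod_cast hp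
  have hp0 : (0 : ℝ) < p := by linarith
  have hcube : ∀ a : ℝ, 0 ≤ a → (a ^ (1 / 3 : ℝ)) ^ 3 = a := fun a ha => by
    rw [← rpow_natCast, ← rpow_mul ha]; norm_num
  set m : ℝ := (n : ℝ) ^ (1 / 3 : ℝ)
  have hm : 1 ≤ m := one_le_rpow hn' (by norm_num)
  have hnm : (n : ℝ) = m ^ 3 := (hcube n (by positivity)).symm
  have hL : (s : ℝ) * log p ≤ m ^ 2 := by
    have h0 : 0 ≤ (s : ℝ) * log p := mul_nonneg (by positivity) (log_nonneg (by linarith))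
    have h := rpow_le_rpow (by positivity) hlog (by norm_num : (0 : ℝ) ≤ 2 / 3)
    rw [← rpow_mul h0, hnm, ← rpow_natCast, ← rpow_mul (by positivity)] at h
    norm_num at h
    exact h
  have : IsProbabilityMeasure (gaussMat n p) := by unfold gaussMat; infer_instance
  let bad : (Fin s → Fin p) × (Fin s → Fin (2 * p + 1)) → Set (Fin n → Fin p → ℝ) := fun q =>
    {x | Function.Injective q.1 ∧ ∑ j, gridPoint p (q.2 j) ^ 2 ≤ 1 ∧
      K * n < ∑ i, |∑ j, x i (q.1 j) * gridPoint p (q.2 j)| ^ 3}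
  have hbad : ∀ q, (gaussMat n p).real (bad q) ≤ 3 * exp (-4 * m ^ 2) := fun q => by
    by_cases h : Function.Injective q.1 ∧ ∑ j, gridPoint p (q.2 j) ^ 2 ≤ 1
    · refine (measureReal_mono fun x hx => ?_).trans
        ((gaussMat_sum_abs_cube_comp_gt_le h.1 _ h.2 (K * n)).trans (htail n m hm hnm))
      exact hx.2.2
    · have : bad q = ∅ := Set.eq_empty_of_forall_notMem fun x hx => h ⟨hx.1, hx.2.1⟩
      rw [this, measureReal_empty]
      positivity
  have hunion : (gaussMat n p).real (⋃ q, bad q) ≤ 6 * (p : ℝ) ^ (-(s : ℝ)) := by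
    have hcount : (p : ℝ) ^ s * (2 * p + 1) ^ s ≤ exp (3 * (s * log p)) := by
      have e : exp (3 * (s * log p)) = ((p : ℝ) ^ 3) ^ s := by
        rw [mul_left_comm, exp_nat_mul, mul_comm, exp_mul, exp_log hp0]
        norm_cast
      rw [e, ← mul_pow]
      gcongr
      nlinarith [mul_nonneg (sq_nonneg (p : ℝ)) (sub_nonneg.2 hp')]
    have hexp : (p : ℝ) ^ (-(s : ℝ)) = exp (-(s * log p)) := by
      rw [rpow_def_of_pos hp0]; ring_nf
    refine (measureReal_iUnion_fintype_le _).trans ?_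
    calc ∑ q, (gaussMat n p).real (bad q)
        ≤ ∑ _q : (Fin s → Fin p) × (Fin s → Fin (2 * p + 1)), 3 * exp (-4 * m ^ 2) :=
          Finset.sum_le_sum fun q _ => hbad q
      _ = (p : ℝ) ^ s * (2 * p + 1) ^ s * (3 * exp (-4 * m ^ 2)) := by simp
      _ ≤ exp (3 * (s * log p)) * (3 * exp (-4 * (s * log p))) := by
          have : exp (-4 * m ^ 2) ≤ exp (-4 * (s * log p)) := exp_le_exp.2 (by linarith)
          gcongr
      _ = 3 * (p : ℝ) ^ (-(s : ℝ)) := by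
          rw [mul_left_comm, ← exp_add, hexp]; ring_nf
      _ ≤ _ := by gcongr; norm_num
  set good := {x : Fin n → Fin p → ℝ | ∀ S : Finset (Fin p), S.Nonempty → S.card ≤ s →
    ∀ u : S → ℝ, (∑ j, u j ^ 2) = 1 →
      (n : ℝ)⁻¹ * ∑ i, |∑ j : S, x i j.1 * u j| ^ 3 ≤ 8 * K}
  have hcover : Set.univ ⊆ good ∪ ⋃ q, bad q := fun x _ => by
    by_cases hx : x ∈ ⋃ q, bad q
    · exact Or.inr hx
    refine Or.inl fun S _ hS u hu => ?_
    obtain ⟨σ, w, hσ, hw, hsum⟩ := exists_injective_sum_extension hsp hS u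
    have hT : (K ^ (1 / 3 : ℝ) * m) ^ 3 = K * n := by
      rw [mul_pow, hcube K hK.le, ← hnm]
    have h := sum_abs_cube_le_of_grid hsp (by omega) (fun i j => x i (σ j))
      (T := K ^ (1 / 3 : ℝ) * m) (by positivity) (fun k hk => by
        rw [hT]
        by_contra! hlt
        exact hx (Set.mem_iUnion.2 ⟨(σ, k), hσ, hk, hlt⟩)) (hw.trans hu).le
    rw [mul_pow, hT] at h
    simp_rw [hsum]
    rw [inv_mul_le_iff₀ (by linarith)]
    linarith
  rw [tsub_le_iff_right]
  calc (1 : ENNReal) = gaussMat n p Set.univ := measure_univ.symm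
    _ ≤ gaussMat n p good + gaussMat n p (⋃ q, bad q) :=
        (measure_mono hcover).trans (measure_union_le _ _)
    _ ≤ _ := by
        gcongr
        rw [← ofReal_measureReal]
        exact ENNReal.ofReal_le_ofReal hunion
end
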